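/- arXiv:1909.05648 — 11 statements merged into one kernel-verified Lean document; each statement's English description precedes it below -/
import Mathlib

section
/- For every positive integer n, α(1,n) = α(2,n) = C(2⌊(n+1)/2⌋, ⌊(n+1)/2⌋), where C(a,b) denotes the binomial coefficient. -/
open Finset

/-- A ±1 matrix: every entry is 1 or -1. -/
def IsPM {m n : ℕ} (M : Matrix (Fin m) (Fin n) ℤ) : Prop :=
  ∀ i j, M i j = 1 ∨ M i j = -1

/-- `goodA m n` is the set A(m,n) of m×n ±1 matrices all of whose row sums and
column sums have absolute value at most 1. -/
def goodA (m n : ℕ) : Set (Matrix (Fin m) (Fin n) ℤ) :=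
  {M | IsPM M ∧ (∀ i, |∑ j, M i j| ≤ 1) ∧ (∀ j, |∑ i, M i j| ≤ 1)}

/-- `alpha m n = |A(m,n)|`. -/
noncomputable def alpha (m n : ℕ) : ℕ := (goodA m n).ncard

/-- The subsets of `Fin n` whose size differs from the size of their complement by at most 1. -/
def balancedSets (n : ℕ) : Finset (Finset (Fin n)) :=
  {s | |2 * (#s : ℤ) - n| ≤ 1}

lemma mem_balancedSets {n : ℕ} {s : Finset (Fin n)} :
    s ∈ balancedSets n ↔ |2 * (#s : ℤ) - n| ≤ 1 := by
  simp [balancedSets]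

lemma card_balancedSets (n : ℕ) :
    #(balancedSets n) = Nat.choose (2 * ((n + 1) / 2)) ((n + 1) / 2) := by
  obtain ⟨k, rfl | rfl⟩ := Nat.even_or_odd' n
  · have h : balancedSets (2 * k) = powersetCard k univ := by
      ext s
      rw [mem_balancedSets, mem_powersetCard_univ, abs_le]
      omega
    have hk : (2 * k + 1) / 2 = k := by omega
    rw [h, hk, card_powersetCard, card_univ, Fintype.card_fin]
  · have h : balancedSets (2 * k + 1) = powersetCard k univ ∪ powersetCard (k + 1) univ := by
      ext s
      rw [mem_balancedSets, mem_union, mem_powersetCard_univ, mem_powersetCard_univ, abs_le]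
      omega
    have hk : (2 * k + 1 + 1) / 2 = k + 1 := by omega
    rw [h, hk, card_union_of_disjoint, card_powersetCard, card_powersetCard, card_univ,
      Fintype.card_fin, show 2 * (k + 1) = 2 * k + 1 + 1 by ring, Nat.choose_succ_succ' (2 * k + 1) k]
    exact pairwise_disjoint_powersetCard (univ : Finset (Fin (2 * k + 1)))
      (Nat.succ_ne_self k).symm

lemma sum_ite_mem_one_neg_one {n : ℕ} (s : Finset (Fin n)) :
    ∑ j, (if j ∈ s then (1 : ℤ) else -1) = 2 * #s - n := by
  have h (j : Fin n) : (if j ∈ s then (1 : ℤ) else -1) = 2 * (if j ∈ s then 1 else 0) - 1 := by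
    split_ifs <;> norm_num
  simp [h, mul_comm]

/-- The one-row ±1 matrix whose entry is 1 exactly at the columns in `s`. -/
def signRow {n : ℕ} (s : Finset (Fin n)) : Matrix (Fin 1) (Fin n) ℤ :=
  fun _ j => if j ∈ s then 1 else -1

/-- The two-row ±1 matrix with first row `signRow s` and second row its negative. -/
def signRows {n : ℕ} (s : Finset (Fin n)) : Matrix (Fin 2) (Fin n) ℤ :=
  ![fun j => if j ∈ s then 1 else -1, fun j => -(if j ∈ s then 1 else -1)]

lemma ite_mem_one_neg_one_injective {n : ℕ} :
    Function.Injective fun (s : Finset (Fin n)) j => if j ∈ s then (1 : ℤ) else -1 := by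
  intro s t h
  ext j
  have := congrFun h j
  by_cases hs : j ∈ s <;> by_cases ht : j ∈ t <;> simp_all

lemma exists_eq_ite_mem {n : ℕ} {f : Fin n → ℤ} (hf : ∀ j, f j = 1 ∨ f j = -1) :
    ∃ s : Finset (Fin n), f = fun j => if j ∈ s then 1 else -1 := by
  refine ⟨univ.filter (f · = 1), funext fun j => ?_⟩
  rcases hf j with h | h <;> simp [h]

lemma goodA_one_eq_image (n : ℕ) : goodA 1 n = signRow '' (balancedSets n : Set (Finset (Fin n))) := by
  ext M
  constructor
  · rintro ⟨hpm, hrow, -⟩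
    obtain ⟨s, hs⟩ := exists_eq_ite_mem (hpm 0)
    refine ⟨s, ?_, ?_⟩
    · rw [mem_coe, mem_balancedSets, ← sum_ite_mem_one_neg_one]
      simpa [hs] using hrow 0
    · ext i j
      rw [Subsingleton.elim i 0, hs, signRow]
  · rintro ⟨s, hs, rfl⟩
    rw [mem_coe, mem_balancedSets, ← sum_ite_mem_one_neg_one] at hs
    refine ⟨fun i j => ite_eq_or_eq _ _ _, fun i => hs, fun j => ?_⟩
    by_cases h : j ∈ s <;> simp [signRow, h]

lemma goodA_two_eq_image (n : ℕ) : goodA 2 n = signRows '' (balancedSets n : Set (Finset (Fin n))) := by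
  ext M
  constructor
  · rintro ⟨hpm, hrow, hcol⟩
    obtain ⟨s, hs⟩ := exists_eq_ite_mem (hpm 0)
    have hneg (j : Fin n) : M 1 j = -M 0 j := by
      have h := hcol j
      rw [Fin.sum_univ_two, abs_le] at h
      have h0 := hpm 0 j
      have h1 := hpm 1 j
      omega
    refine ⟨s, ?_, ?_⟩
    · rw [mem_coe, mem_balancedSets, ← sum_ite_mem_one_neg_one]
      simpa [hs] using hrow 0
    · ext i j
      fin_cases i
      · simp [signRows, hs]
      · simp [signRows, hneg, hs]
  · rintro ⟨s, hs, rfl⟩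
    rw [mem_coe, mem_balancedSets, ← sum_ite_mem_one_neg_one] at hs
    refine ⟨fun i j => ?_, fun i => ?_, fun j => ?_⟩
    · fin_cases i <;> by_cases h : j ∈ s <;> simp [signRows, h]
    · fin_cases i
      · exact hs
      · change |∑ j, -(if j ∈ s then (1 : ℤ) else -1)| ≤ 1
        rwa [sum_neg_distrib, abs_neg]
    · simp [signRows, Fin.sum_univ_two]

theorem stmt0 (n : ℕ) (hn : 0 < n) :
    alpha 1 n = Nat.choose (2 * ((n + 1) / 2)) ((n + 1) / 2) ∧
    alpha 2 n = Nat.choose (2 * ((n + 1) / 2)) ((n + 1) / 2) := by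
  constructor
  · rw [alpha, goodA_one_eq_image, Set.ncard_image_of_injective, Set.ncard_coe_finset,
      card_balancedSets]
    exact fun s t h => ite_mem_one_neg_one_injective (congrFun h 0)
  · rw [alpha, goodA_two_eq_image, Set.ncard_image_of_injective, Set.ncard_coe_finset,
      card_balancedSets]
    exact fun s t h => ite_mem_one_neg_one_injective (congrFun h 0)
end

section
/- If m is even, then α(m,n) ≤ α(m-1,n) for every positive integer n. Moreover, if m and n are both even, then α(m,n) = α(m-1,n) = α(m,n-1) ≤ α(m-1,n-1). -/
open Finset

theorem two_dvd_sum_sub_of_pm {k : ℕ} (f : Fin k → ℤ) (hf : ∀ i, f i = 1 ∨ f i = -1) :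
    (2 : ℤ) ∣ ∑ i, f i - k := by
  have h : ∑ i, f i - k = ∑ i, (f i - 1) := by simp [Finset.sum_sub_distrib]
  rw [h]
  refine Finset.dvd_sum fun i _ => ?_
  rcases hf i with h | h <;> simp [h]

theorem sum_eq_zero_of_pm_of_even {k : ℕ} (hk : Even k) (f : Fin k → ℤ)
    (hf : ∀ i, f i = 1 ∨ f i = -1) (hs : |∑ i, f i| ≤ 1) : ∑ i, f i = 0 := by
  have h := two_dvd_sum_sub_of_pm f hf
  rw [abs_le] at hs
  obtain ⟨t, rfl⟩ := hk
  omega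

theorem sum_pm_of_pm_of_odd {k : ℕ} (hk : Odd k) (f : Fin k → ℤ)
    (hf : ∀ i, f i = 1 ∨ f i = -1) (hs : |∑ i, f i| ≤ 1) :
    ∑ i, f i = 1 ∨ ∑ i, f i = -1 := by
  have h := two_dvd_sum_sub_of_pm f hf
  rw [abs_le] at hs
  obtain ⟨t, rfl⟩ := hk
  omega

theorem goodA_finite (m n : ℕ) : (goodA m n).Finite := by
  have h : (Set.pi Set.univ fun _ : Fin m =>
      Set.pi Set.univ fun _ : Fin n => ({1, -1} : Set ℤ)).Finite :=
    Set.Finite.pi fun _ => Set.Finite.pi fun _ => Set.toFinite _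
  exact h.subset fun M hM i _ j _ => hM.1 i j

theorem alpha_comm (m n : ℕ) : alpha m n = alpha n m :=
  Set.ncard_congr (fun M _ => M.transpose)
    (fun _ hM => ⟨fun i j => hM.1 j i, hM.2.2, hM.2.1⟩)
    (fun _ _ _ _ h => Matrix.transpose_injective h)
    (fun M hM => ⟨M.transpose, ⟨fun i j => hM.1 j i, hM.2.2, hM.2.1⟩, M.transpose_transpose⟩)

theorem last_row_eq_of_mem_goodA {k n : ℕ} (hk : Even (k + 1))
    {M : Matrix (Fin (k + 1)) (Fin n) ℤ} (hM : M ∈ goodA (k + 1) n) (j : Fin n) :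
    M (Fin.last k) j = -∑ i : Fin k, M i.castSucc j := by
  have h := sum_eq_zero_of_pm_of_even hk (fun i => M i j) (fun i => hM.1 i j) (hM.2.2 j)
  rw [Fin.sum_univ_castSucc] at h
  linarith

theorem submatrix_castSucc_mem_goodA {k n : ℕ} (hk : Even (k + 1))
    {M : Matrix (Fin (k + 1)) (Fin n) ℤ} (hM : M ∈ goodA (k + 1) n) :
    M.submatrix Fin.castSucc id ∈ goodA k n := by
  refine ⟨fun i j => hM.1 _ j, fun i => hM.2.1 _, fun j => ?_⟩
  have h := last_row_eq_of_mem_goodA hk hM j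
  have h1 := hM.1 (Fin.last k) j
  simp only [Matrix.submatrix_apply, id]
  rw [abs_le]
  omega

theorem submatrix_castSucc_injOn_goodA {k n : ℕ} (hk : Even (k + 1)) :
    Set.InjOn (fun M : Matrix (Fin (k + 1)) (Fin n) ℤ => M.submatrix Fin.castSucc id)
      (goodA (k + 1) n) := by
  intro M hM N hN h
  have h' : ∀ (i : Fin k) j, M i.castSucc j = N i.castSucc j := fun i j => congrFun₂ h i j
  ext i j
  induction i using Fin.lastCases with
  | last => simp [last_row_eq_of_mem_goodA hk hM, last_row_eq_of_mem_goodA hk hN, h']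
  | cast i => exact h' i j

theorem alpha_succ_le {k : ℕ} (n : ℕ) (hk : Even (k + 1)) : alpha (k + 1) n ≤ alpha k n :=
  Set.ncard_le_ncard_of_injOn _ (fun _ hM => submatrix_castSucc_mem_goodA hk hM)
    (submatrix_castSucc_injOn_goodA hk) (goodA_finite k n)

theorem exists_submatrix_castSucc_eq {k n : ℕ} (hk : Even (k + 1)) (hn : Even n)
    {N : Matrix (Fin k) (Fin n) ℤ} (hN : N ∈ goodA k n) :
    ∃ M ∈ goodA (k + 1) n, M.submatrix Fin.castSucc id = N := by
  have hodd : Odd k := by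
    rcases Nat.even_or_odd k with h | h
    · exact absurd hk (by simpa using h.add_one)
    · exact h
  refine ⟨Matrix.of fun i j => Fin.snoc (α := fun _ => ℤ) (fun i => N i j) (-∑ i, N i j) i, ⟨?_, ?_, ?_⟩, ?_⟩
  · intro i j
    induction i using Fin.lastCases with
    | last =>
      have := sum_pm_of_pm_of_odd hodd (fun i => N i j) (fun i => hN.1 i j) (hN.2.2 j)
      simp only [Matrix.of_apply, Fin.snoc_last]
      omega
    | cast i => simpa using hN.1 i j
  · intro i
    induction i using Fin.lastCases with
    | last =>
      have h : ∑ j, ∑ i, N i j = 0 := by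
        rw [Finset.sum_comm]
        exact Finset.sum_eq_zero fun i _ =>
          sum_eq_zero_of_pm_of_even hn (N i) (hN.1 i) (hN.2.1 i)
      simp [h]
    | cast i => simpa using hN.2.1 i
  · intro j
    simp [Fin.sum_univ_castSucc]
  · ext i j
    simp

theorem alpha_succ_eq {k n : ℕ} (hk : Even (k + 1)) (hn : Even n) :
    alpha (k + 1) n = alpha k n :=
  Set.ncard_congr (fun M _ => M.submatrix Fin.castSucc id)
    (fun _ hM => submatrix_castSucc_mem_goodA hk hM)
    (fun _ _ hM hN h => submatrix_castSucc_injOn_goodA hk hM hN h)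
    (fun _ hN => by
      obtain ⟨M, hM, h⟩ := exists_submatrix_castSucc_eq hk hn hN
      exact ⟨M, hM, h⟩)

theorem stmt1 (m n : ℕ) (hm : Even m) (hm0 : 0 < m) (hn : 0 < n) :
    alpha m n ≤ alpha (m - 1) n ∧
    (Even n →
      alpha m n = alpha (m - 1) n ∧
      alpha (m - 1) n = alpha m (n - 1) ∧
      alpha m (n - 1) ≤ alpha (m - 1) (n - 1)) := by
  obtain ⟨k, rfl⟩ := Nat.exists_eq_add_of_lt hm0
  obtain ⟨l, rfl⟩ := Nat.exists_eq_add_of_lt hn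
  simp only [zero_add, Nat.add_sub_cancel] at hm ⊢
  refine ⟨alpha_succ_le _ hm, fun hne => ⟨alpha_succ_eq hm hne, ?_, alpha_succ_le _ hm⟩⟩
  rw [← alpha_succ_eq hm hne, alpha_comm, alpha_succ_eq hne hm, alpha_comm]
end

section
/- For every positive integer k, α(3,2k) = C(2k,k) · Σ_{i=0}^{k} C(k,i)² · C(2i,i), where C(a,b) denotes the binomial coefficient. -/
open Finset

/-- Subsets of `U` meeting `S` and its complement in equally many elements, weighted by that
number. -/
lemma sum_balanced_powerset {α : Type*} [DecidableEq α] (U S : Finset α) (m : ℕ)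
    (h₁ : #(U ∩ S) = m) (h₂ : #(U \ S) = m) (f : ℕ → ℕ) :
    ∑ X ∈ U.powerset with #(X ∩ S) = #(X \ S), f #(X ∩ S) =
      ∑ i ∈ range (m + 1), m.choose i ^ 2 * f i := by
  have hmaps : ∀ X ∈ U.powerset.filter (fun X => #(X ∩ S) = #(X \ S)),
      #(X ∩ S) ∈ range (m + 1) := by
    intro X hX
    simp only [mem_filter, mem_powerset] at hX
    have := card_le_card (inter_subset_inter_right (u := S) hX.1)
    simp only [mem_range]
    omega
  rw [← sum_fiberwise_of_maps_to hmaps]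
  refine sum_congr rfl fun i _ => ?_
  rw [sum_congr rfl (g := fun _ => f i)
    (fun X hX => by rw [(mem_filter.mp hX).2]), sum_const, smul_eq_mul]
  congr 1
  have hcard : #(powersetCard i (U ∩ S) ×ˢ powersetCard i (U \ S)) = m.choose i ^ 2 := by
    rw [card_product, card_powersetCard, card_powersetCard, h₁, h₂, sq]
  rw [← hcard]
  refine card_nbij' (fun X => (X ∩ S, X \ S)) (fun p => p.1 ∪ p.2) ?_ ?_ ?_ ?_
  · intro X hX
    simp only [coe_filter, mem_filter, mem_powerset, Set.mem_ofPred_eq] at hX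
    simp only [coe_product, Set.mem_prod, mem_coe, mem_powersetCard]
    exact ⟨⟨inter_subset_inter_right hX.1.1, hX.2⟩,
      sdiff_subset_sdiff hX.1.1 subset_rfl, hX.1.2 ▸ hX.2⟩
  · rintro ⟨A, B⟩ hp
    simp only [coe_product, Set.mem_prod, mem_coe, mem_powersetCard] at hp
    obtain ⟨⟨hA, hAi⟩, hB, hBi⟩ := hp
    have e₁ : (A ∪ B) ∩ S = A := by grind
    have e₂ : (A ∪ B) \ S = B := by grind
    simp only [coe_filter, mem_filter, mem_powerset, Set.mem_ofPred_eq, e₁, e₂, hAi, hBi, and_true]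
    grind
  · intro X _
    ext x; grind
  · rintro ⟨A, B⟩ hp
    simp only [coe_product, Set.mem_prod, mem_coe, mem_powersetCard] at hp
    ext x <;> grind

/-- The indicator sign of a set of columns. -/
def colSign {n : ℕ} (S : Finset (Fin n)) (j : Fin n) : ℤ := if j ∈ S then 1 else -1

/-- The 3-row matrix whose `j`-th column has sum `colSign S j`, the entry of opposite sign being
in row 0 for `j ∈ Y`, in row 1 for `j ∈ X \ Y`, and in row 2 for `j ∉ X`. -/
def matrixOfSets {n : ℕ} (p : Finset (Fin n) × Finset (Fin n) × Finset (Fin n)) :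
    Matrix (Fin 3) (Fin n) ℤ :=
  Matrix.of ![fun j => if j ∈ p.2.2 then -colSign p.1 j else colSign p.1 j,
    fun j => if j ∈ p.2.1 \ p.2.2 then -colSign p.1 j else colSign p.1 j,
    fun j => if j ∈ p.2.1 then colSign p.1 j else -colSign p.1 j]

lemma sum_colSign {n : ℕ} (S X : Finset (Fin n)) :
    ∑ j ∈ X, colSign S j = (#(X ∩ S) : ℤ) - #(X \ S) := by
  simp only [colSign, sum_ite, sum_const, filter_mem_eq_inter, filter_notMem_eq_sdiff]
  simp [sub_eq_add_neg]

lemma sum_ite_neg {n : ℕ} (X : Finset (Fin n)) (f : Fin n → ℤ) :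
    ∑ j, (if j ∈ X then -f j else f j) = ∑ j, f j - 2 * ∑ j ∈ X, f j := by
  have h : ∑ j ∈ X, f j = ∑ j, if j ∈ X then f j else 0 := by simp
  rw [h, mul_sum, ← sum_sub_distrib]
  refine sum_congr rfl fun j _ => ?_
  split_ifs <;> ring

/-- Triples of column sets parametrizing the good `3 × 2k` matrices. -/
def balancedTriples (k : ℕ) :
    Finset (Finset (Fin (2 * k)) × Finset (Fin (2 * k)) × Finset (Fin (2 * k))) :=
  {p | #p.1 = k ∧ #(p.2.1 ∩ p.1) = #(p.2.1 \ p.1) ∧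
    p.2.2 ⊆ p.2.1 ∧ #(p.2.2 ∩ p.1) = #(p.2.2 \ p.1)}

lemma matrixOfSets_mem_goodA_iff {k : ℕ} {S X Y : Finset (Fin (2 * k))} (hYX : Y ⊆ X) :
    matrixOfSets (S, X, Y) ∈ goodA 3 (2 * k) ↔ (S, X, Y) ∈ balancedTriples k := by
  have hpm : IsPM (matrixOfSets (S, X, Y)) := by
    intro i j
    fin_cases i <;> simp only [matrixOfSets, colSign] <;> simp <;> split_ifs <;> simp
  have hcol : ∀ j, |∑ i, matrixOfSets (S, X, Y) i j| ≤ 1 := by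
    intro j
    have := @hYX j
    simp only [Fin.sum_univ_three, matrixOfSets, colSign]
    simp only [Matrix.of_apply, Matrix.cons_val, mem_sdiff]
    split_ifs <;> simp_all
  have hσ : ∑ j, colSign S j = 2 * (#S : ℤ) - 2 * k := by
    have hc := card_sdiff_add_card_inter (univ : Finset (Fin (2 * k))) S
    rw [sum_colSign]
    simp only [univ_inter, card_univ, Fintype.card_fin] at hc ⊢
    omega
  have h0 : ∑ j, matrixOfSets (S, X, Y) 0 j = ∑ j, colSign S j - 2 * ∑ j ∈ Y, colSign S j :=
    sum_ite_neg Y _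
  have h1 : ∑ j, matrixOfSets (S, X, Y) 1 j =
      ∑ j, colSign S j - 2 * ∑ j ∈ X \ Y, colSign S j :=
    sum_ite_neg (X \ Y) _
  have h2 : ∑ j, matrixOfSets (S, X, Y) 2 j =
      -(∑ j, colSign S j - 2 * ∑ j ∈ X, colSign S j) := by
    rw [← sum_ite_neg X, ← sum_neg_distrib]
    refine sum_congr rfl fun j _ => ?_
    change (if j ∈ X then colSign S j else -colSign S j) = _
    split_ifs <;> simp
  have hXY := sum_sdiff hYX (f := colSign S)
  simp only [goodA, Set.mem_ofPred_eq, hpm, hcol, Fin.forall_fin_succ, IsEmpty.forall_iff,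
    balancedTriples, mem_filter, mem_univ, true_and, hYX, implies_true, and_true]
  simp only [Fin.succ_zero_eq_one, Fin.succ_one_eq_two, h0, h1, h2, abs_le]
  have hX := sum_colSign S X
  have hY := sum_colSign S Y
  constructor
  · rintro ⟨_, _, _, _⟩
    omega
  · rintro ⟨_, _, _⟩
    omega

lemma injOn_matrixOfSets (k : ℕ) :
    Set.InjOn matrixOfSets (SetLike.coe (balancedTriples k)) := by
  rintro ⟨S, X, Y⟩ h ⟨S', X', Y'⟩ h' heq
  have hYX : Y ⊆ X := (mem_filter.mp h).2.2.2.1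
  have hYX' : Y' ⊆ X' := (mem_filter.mp h').2.2.2.1
  have key : ∀ j, (j ∈ S ↔ j ∈ S') ∧ (j ∈ X ↔ j ∈ X') ∧ (j ∈ Y ↔ j ∈ Y') := by
    intro j
    have e0 := congrFun (congrFun heq 0) j
    have e1 := congrFun (congrFun heq 1) j
    have e2 := congrFun (congrFun heq 2) j
    have := @hYX j
    have := @hYX' j
    simp only [matrixOfSets, colSign, Matrix.of_apply, Matrix.cons_val, mem_sdiff] at *
    by_cases j ∈ S <;> by_cases j ∈ S' <;> by_cases j ∈ X <;> by_cases j ∈ X' <;>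
      by_cases j ∈ Y <;> by_cases j ∈ Y' <;> simp_all
  simp only [Prod.mk.injEq]
  exact ⟨ext fun j => (key j).1, ext fun j => (key j).2.1, ext fun j => (key j).2.2⟩

lemma goodA_eq_image (k : ℕ) :
    goodA 3 (2 * k) = matrixOfSets '' (SetLike.coe (balancedTriples k)) := by
  apply Set.Subset.antisymm
  · intro M hM
    have hent : ∀ j, (M 0 j = 1 ∨ M 0 j = -1) ∧ (M 1 j = 1 ∨ M 1 j = -1) ∧
        (M 2 j = 1 ∨ M 2 j = -1) ∧ |M 0 j + M 1 j + M 2 j| ≤ 1 := fun j =>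
      ⟨hM.1 0 j, hM.1 1 j, hM.1 2 j, by simpa [Fin.sum_univ_three] using hM.2.2 j⟩
    let S : Finset (Fin (2 * k)) := {j | M 0 j + M 1 j + M 2 j = 1}
    let X : Finset (Fin (2 * k)) := {j | M 2 j = M 0 j + M 1 j + M 2 j}
    let Y : Finset (Fin (2 * k)) := {j | M 0 j ≠ M 0 j + M 1 j + M 2 j}
    have hYX : Y ⊆ X := by
      intro j
      obtain ⟨h0 | h0, h1 | h1, h2 | h2, h⟩ := hent j <;> simp [X, Y, h0, h1, h2] at h ⊢
    have heq : matrixOfSets (S, X, Y) = M := by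
      ext i j
      obtain ⟨h0 | h0, h1 | h1, h2 | h2, h⟩ := hent j <;> fin_cases i <;>
        simp [matrixOfSets, colSign, S, X, Y, h0, h1, h2] at h ⊢
    exact ⟨_, (matrixOfSets_mem_goodA_iff hYX).1 (heq ▸ hM), heq⟩
  · rintro _ ⟨⟨S, X, Y⟩, hp, rfl⟩
    refine (matrixOfSets_mem_goodA_iff ?_).2 hp
    exact (mem_filter.mp hp).2.2.2.1

lemma card_balancedTriples (k : ℕ) :
    #(balancedTriples k) =
      (2 * k).choose k * ∑ i ∈ range (k + 1), k.choose i ^ 2 * (2 * i).choose i := by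
  have hbal : ∀ U S : Finset (Fin (2 * k)), #(U ∩ S) = #(U \ S) →
      #{Y ∈ U.powerset | #(Y ∩ S) = #(Y \ S)} = (2 * #(U ∩ S)).choose #(U ∩ S) := by
    intro U S h
    have := sum_balanced_powerset U S _ rfl h.symm (fun _ => 1)
    simp only [sum_const, smul_eq_mul, mul_one, Nat.sum_range_choose_sq] at this
    rw [this]
  have hsig : #(balancedTriples k) =
      ∑ S ∈ powersetCard k (univ : Finset (Fin (2 * k))),
        ∑ X ∈ (univ : Finset (Fin (2 * k))).powerset with #(X ∩ S) = #(X \ S),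
          #{Y ∈ X.powerset | #(Y ∩ S) = #(Y \ S)} := by
    simp only [← card_sigma]
    refine card_nbij' (fun p => ⟨p.1, p.2.1, p.2.2⟩) (fun q => (q.1, q.2.1, q.2.2)) ?_ ?_ ?_ ?_
    · rintro ⟨S, X, Y⟩ hp
      simpa [balancedTriples, mem_powersetCard] using hp
    · rintro ⟨S, X, Y⟩ hp
      simpa [balancedTriples, mem_powersetCard] using hp
    · intro _ _; rfl
    · intro _ _; rfl
  rw [hsig, sum_congr rfl (g := fun _ => ∑ i ∈ range (k + 1), k.choose i ^ 2 * (2 * i).choose i)]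
  · simp [card_powersetCard]
  · intro S hS
    have hS := (mem_powersetCard.mp hS).2
    rw [sum_congr rfl fun X hX => hbal X S (mem_filter.mp hX).2]
    have hc := card_sdiff_add_card_inter (univ : Finset (Fin (2 * k))) S
    simp only [univ_inter, card_univ, Fintype.card_fin] at hc
    exact sum_balanced_powerset univ S k (by simpa using hS) (by omega)
      (fun i => (2 * i).choose i)

theorem stmt3 (k : ℕ) (hk : 0 < k) :
    alpha 3 (2 * k) =
      Nat.choose (2 * k) k *
        ∑ i ∈ Finset.range (k + 1), (Nat.choose k i) ^ 2 * Nat.choose (2 * i) i := by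
  rw [alpha, goodA_eq_image, (injOn_matrixOfSets k).ncard_image,
    Set.ncard_coe_finset, card_balancedTriples]
end

section
/- For every nonnegative integer k, α(3,2k+1) = 2·C(2k+1,k) · Σ_{i=0}^{k} C(k,i) · [ C(2i+1,i+1)·C(k+1,i) + 2·C(k+1,i+1)·C(2i+1,i) ], where C(a,b) denotes the binomial coefficient. -/
open Finset

theorem sum_choose_mul_choose_add (i a b : ℕ) :
    ∑ p ∈ range (i + 1), i.choose p * (i + a).choose (p + b) = (2 * i + a).choose (i + b) := by
  have h : 2 * i + a = i + (i + a) := by ring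
  rw [h, Nat.add_choose_eq, Finset.Nat.sum_antidiagonal_eq_sum_range_succ_mk,
    ← Finset.sum_range_reflect]
  have hsub : range (i + 1) ⊆ range (i + b).succ := by
    intro x; simp only [mem_range]; omega
  rw [← Finset.sum_subset hsub]
  · refine Finset.sum_congr rfl fun p hp => ?_
    have hp' : p ≤ i := by simpa [Nat.lt_succ_iff] using hp
    have h1 : i + 1 - 1 - p = i - p := by omega
    have h2 : i - p + b = i + b - p := by omega
    simp only [h1, h2, Nat.choose_symm hp']
  · intro x _ hx
    have : i < x := by simpa using hx
    simp [Nat.choose_eq_zero_of_lt this]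

/-- Weights of the pairs `(j, t)` for which both `t - p` and `(j - t) - (i - p)` lie in
`{0, 1}`. -/
theorem sum_choose_mul_choose_ite (n i p : ℕ) (hp : p ≤ i) :
    ∑ j ∈ range (n + 1), n.choose j * ∑ t ∈ range (j + 1), j.choose t *
      (if (t = p ∨ t = p + 1) ∧ (j + p = i + t ∨ j + p = i + t + 1) then 1 else 0) =
    n.choose i * i.choose p + n.choose (i + 1) * (i + 1).choose (p + 1) +
      n.choose (i + 1) * (i + 1).choose p + n.choose (i + 2) * (i + 2).choose (p + 1) := by
  have single : ∀ a b : ℕ, b ≤ a → ∑ j ∈ range (n + 1), n.choose j * ∑ t ∈ range (j + 1),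
      j.choose t * (if t = b ∧ j = a then 1 else 0) = n.choose a * a.choose b := by
    intro a b hb
    rw [Finset.sum_eq_single a]
    · rw [Finset.sum_eq_single b]
      · simp
      · intro t _ ht; simp [ht]
      · intro h; exact absurd (mem_range.2 (by omega)) h
    · intro j _ hj; simp [hj]
    · intro h
      have : n < a := by simpa using h
      simp [Nat.choose_eq_zero_of_lt this]
  rw [← single i p hp, ← single (i + 1) (p + 1) (by omega), ← single (i + 1) p (by omega),
    ← single (i + 2) (p + 1) (by omega)]
  simp only [← Finset.sum_add_distrib, ← mul_add]
  refine Finset.sum_congr rfl fun j _ => ?_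
  congr 1
  refine Finset.sum_congr rfl fun t _ => ?_
  congr 1
  split_ifs <;> omega

theorem choose_succ_mul_choose_succ_add (k i : ℕ) :
    (2 * (i + 1)).choose (i + 1) *
      (k.choose (i + 1) * (k + 1).choose (i + 1) + k.choose i * (k + 1).choose (i + 2)) =
    k.choose (i + 1) * ((2 * (i + 1) + 1).choose (i + 2) * (k + 1).choose (i + 1)) := by
  have h1 := Nat.choose_succ_right_eq k i
  have h2 := Nat.choose_succ_right_eq (k + 1) (i + 1)
  have h3 := Nat.add_one_mul_choose_eq (2 * (i + 1)) (i + 1)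
  have h4 : k + 1 - (i + 1) = k - i := by omega
  rw [h4] at h2
  simp only [show i + 1 + 1 = i + 2 from rfl] at *
  have h5 : k.choose i * (k + 1).choose (i + 2) * (i + 2) =
      k.choose (i + 1) * (k + 1).choose (i + 1) * (i + 1) := by
    calc _ = k.choose i * ((k + 1).choose (i + 2) * (i + 2)) := by ring
      _ = (k.choose i * (k - i)) * (k + 1).choose (i + 1) := by rw [h2]; ring
      _ = _ := by rw [← h1]; ring
  apply Nat.eq_of_mul_eq_mul_right (show 0 < i + 2 by omega)
  calc _ = (2 * (i + 1)).choose (i + 1) * (k.choose (i + 1) * (k + 1).choose (i + 1) * (i + 2) +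
          k.choose i * (k + 1).choose (i + 2) * (i + 2)) := by ring
    _ = ((2 * (i + 1) + 1) * (2 * (i + 1)).choose (i + 1)) *
          (k.choose (i + 1) * (k + 1).choose (i + 1)) := by rw [h5]; ring
    _ = _ := by rw [h3]; ring

theorem sum_choose_mul_centralBinom (k : ℕ) :
    ∑ i ∈ range (k + 1), k.choose i * ((2 * i).choose i * (k + 1).choose i +
      (2 * i + 2).choose (i + 1) * (k + 1).choose (i + 2)) =
    ∑ i ∈ range (k + 1), k.choose i * ((2 * i + 1).choose (i + 1) * (k + 1).choose i) := by
  simp only [mul_add, Finset.sum_add_distrib]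
  rw [Finset.sum_range_succ', Finset.sum_range_succ' (fun i => k.choose i *
    ((2 * i + 1).choose (i + 1) * (k + 1).choose i)),
    Finset.sum_range_succ (fun i => k.choose i *
      ((2 * i + 2).choose (i + 1) * (k + 1).choose (i + 2)))]
  rw [Nat.choose_eq_zero_of_lt (show k + 1 < k + 2 by omega), mul_zero ((2 * k + 2).choose _), mul_zero (k.choose k), Nat.add_zero (∑ _ ∈ _, _),
    add_right_comm, ← Finset.sum_add_distrib]
  congr 1
  refine Finset.sum_congr rfl fun i _ => ?_
  rw [← choose_succ_mul_choose_succ_add]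
  ring_nf

theorem sum_choose_ite_eq (k : ℕ) :
    ∑ i ∈ range (k + 1), k.choose i * ∑ p ∈ range (i + 1), i.choose p *
      ∑ j ∈ range (k + 1 + 1), (k + 1).choose j * ∑ t ∈ range (j + 1), j.choose t *
        (if (t = p ∨ t = p + 1) ∧ (j + p = i + t ∨ j + p = i + t + 1) then 1 else 0) =
    ∑ i ∈ range (k + 1), k.choose i * ((2 * i + 1).choose (i + 1) * (k + 1).choose i +
      2 * (k + 1).choose (i + 1) * (2 * i + 1).choose i) := by
  simp only [mul_add (k.choose _), Finset.sum_add_distrib]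
  rw [← sum_choose_mul_centralBinom, ← Finset.sum_add_distrib]
  refine Finset.sum_congr rfl fun i _ => ?_
  rw [← mul_add]
  congr 1
  have h1 := sum_choose_mul_choose_add i 0 0
  have h2 := sum_choose_mul_choose_add i 1 1
  have h3 := sum_choose_mul_choose_add i 1 0
  have h4 := sum_choose_mul_choose_add i 2 1
  have h5 : (2 * i + 1).choose (i + 1) = (2 * i + 1).choose i :=
    Nat.choose_symm_half i
  rw [h5] at h2
  simp only [add_zero] at h1 h3
  rw [← h1, ← h4, two_mul, add_mul]
  nth_rw 1 [← h2]
  rw [← h3]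
  simp only [Finset.sum_mul, Finset.mul_sum, ← Finset.sum_add_distrib]
  refine Finset.sum_congr rfl fun p hp => ?_
  have := sum_choose_mul_choose_ite (k + 1) i p (by simpa [Nat.lt_succ_iff] using hp)
  simp only [Finset.mul_sum] at this
  simp only [← Finset.mul_sum] at this ⊢
  rw [this]
  ring

/-- Subsets `(B, C)` which, together with `S`, are the positions of the positive entries in the
rows of a matrix in `A(3, 2k+1)`. -/
def goodPairs (k : ℕ) (S : Finset (Fin (2 * k + 1))) :
    Finset (Finset (Fin (2 * k + 1)) × Finset (Fin (2 * k + 1))) :=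
  univ.filter fun x => (#x.1 = k ∨ #x.1 = k + 1) ∧ (#x.2 = k ∨ #x.2 = k + 1) ∧
    ∀ j, ¬(j ∈ S ∧ j ∈ x.1 ∧ j ∈ x.2) ∧ (j ∈ S ∨ j ∈ x.1 ∨ j ∈ x.2)

theorem card_goodPairs_compl (k : ℕ) (S : Finset (Fin (2 * k + 1))) :
    #(goodPairs k Sᶜ) = #(goodPairs k S) := by
  have key : ∀ S : Finset (Fin (2 * k + 1)), ∀ x ∈ goodPairs k S,
      (x.1ᶜ, x.2ᶜ) ∈ goodPairs k Sᶜ := by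
    intro S x hx
    simp only [goodPairs, mem_filter, mem_univ, true_and, card_compl, Fintype.card_fin,
      mem_compl] at hx ⊢
    obtain ⟨h1, h2, h3⟩ := hx
    refine ⟨by omega, by omega, fun j => ?_⟩
    have := h3 j
    tauto
  refine Finset.card_nbij' (fun x => (x.1ᶜ, x.2ᶜ)) (fun x => (x.1ᶜ, x.2ᶜ)) ?_ ?_ ?_ ?_
  · intro x hx
    simpa using key _ x hx
  · exact fun x hx => key _ x hx
  · intro x _; simp
  · intro x _; simp

theorem card_goodPairs (k : ℕ) (S : Finset (Fin (2 * k + 1))) (hS : #S = k) :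
    #(goodPairs k S) =
    ∑ i ∈ range (k + 1), k.choose i * ∑ p ∈ range (i + 1), i.choose p *
      ∑ j ∈ range (k + 1 + 1), (k + 1).choose j * ∑ t ∈ range (j + 1), j.choose t *
        (if (t = p ∨ t = p + 1) ∧ (j + p = i + t ∨ j + p = i + t + 1) then 1 else 0) := by
  have hSc : #Sᶜ = k + 1 := by rw [card_compl, hS, Fintype.card_fin]; omega
  have hsum : ∑ U ∈ S.powerset, ∑ P ∈ U.powerset, ∑ V ∈ Sᶜ.powerset, ∑ T ∈ V.powerset,
      (if (#T = #P ∨ #T = #P + 1) ∧ (#V + #P = #U + #T ∨ #V + #P = #U + #T + 1)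
        then 1 else 0) = ∑ i ∈ range (k + 1), k.choose i * ∑ p ∈ range (i + 1), i.choose p *
      ∑ j ∈ range (k + 1 + 1), (k + 1).choose j * ∑ t ∈ range (j + 1), j.choose t *
        (if (t = p ∨ t = p + 1) ∧ (j + p = i + t ∨ j + p = i + t + 1) then 1 else 0) := by
    have h1 : ∀ i p j : ℕ, ∀ V : Finset (Fin (2 * k + 1)), ∑ T ∈ V.powerset,
        (if (#T = p ∨ #T = p + 1) ∧ (j + p = i + #T ∨ j + p = i + #T + 1) then 1 else 0) =
        ∑ t ∈ range (#V + 1), (#V).choose t *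
          (if (t = p ∨ t = p + 1) ∧ (j + p = i + t ∨ j + p = i + t + 1) then 1 else 0) :=
      fun i p j V => Finset.sum_powerset_apply_card (fun t =>
        if (t = p ∨ t = p + 1) ∧ (j + p = i + t ∨ j + p = i + t + 1) then 1 else 0)
    simp only [h1]
    have h2 := fun i p => Finset.sum_powerset_apply_card (fun j => ∑ t ∈ range (j + 1),
      j.choose t * (if (t = p ∨ t = p + 1) ∧ (j + p = i + t ∨ j + p = i + t + 1)
        then 1 else 0)) (x := Sᶜ)
    simp only [smul_eq_mul, hSc] at h2
    simp only [h2]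
    have h3 := fun i => fun U : Finset (Fin (2 * k + 1)) =>
      Finset.sum_powerset_apply_card (fun p =>
      ∑ j ∈ range (k + 1 + 1), (k + 1).choose j * ∑ t ∈ range (j + 1), j.choose t *
        (if (t = p ∨ t = p + 1) ∧ (j + p = i + t ∨ j + p = i + t + 1) then 1 else 0)) (x := U)
    simp only [smul_eq_mul] at h3
    simp only [h3]
    have h4 := Finset.sum_powerset_apply_card (fun i => ∑ p ∈ range (i + 1), i.choose p *
      ∑ j ∈ range (k + 1 + 1), (k + 1).choose j * ∑ t ∈ range (j + 1), j.choose t *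
        (if (t = p ∨ t = p + 1) ∧ (j + p = i + t ∨ j + p = i + t + 1) then 1 else 0)) (x := S)
    simp only [smul_eq_mul, hS] at h4
    exact h4
  rw [← hsum]
  have hsig : ∀ f : Finset (Fin (2 * k + 1)) → Finset (Fin (2 * k + 1)) →
      Finset (Fin (2 * k + 1)) → Finset (Fin (2 * k + 1)) → ℕ,
      ∑ U ∈ S.powerset, ∑ P ∈ U.powerset, ∑ V ∈ Sᶜ.powerset, ∑ T ∈ V.powerset, f U P V T =
      ∑ x ∈ (S.powerset.sigma fun U => U.powerset) ×ˢ (Sᶜ.powerset.sigma fun V => V.powerset),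
        f x.1.1 x.1.2 x.2.1 x.2.2 := by
    intro f
    rw [Finset.sum_product, Finset.sum_sigma]
    refine Finset.sum_congr rfl fun U _ => Finset.sum_congr rfl fun P _ => ?_
    rw [Finset.sum_sigma]
  rw [hsig, ← Finset.card_filter]
  refine Finset.card_nbij'
    (fun x => (⟨S ∩ (x.1 ∪ x.2), S ∩ x.1⟩, ⟨Sᶜ \ (x.1 ∩ x.2), Sᶜ \ x.1⟩))
    (fun y => (y.1.2 ∪ (Sᶜ \ y.2.2), (y.1.1 \ y.1.2) ∪ (Sᶜ \ (y.2.1 \ y.2.2)))) ?_ ?_ ?_ ?_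
  · rintro ⟨B, C⟩ hx
    simp only [goodPairs, coe_filter, mem_univ, true_and, Set.mem_ofPred_eq] at hx
    obtain ⟨hB, hC, h⟩ := hx
    simp only [coe_filter, Set.mem_ofPred_eq, mem_product, mem_sigma, mem_powerset]
    refine ⟨⟨⟨inter_subset_left, inter_subset_inter_left subset_union_left⟩,
      ⟨sdiff_subset, sdiff_subset_sdiff le_rfl inter_subset_left⟩⟩, ?_⟩
    have e1 : #(S ∩ B) + #(Sᶜ ∩ B) = #B := by
      rw [← card_union_of_disjoint]
      · congr 1; ext j; simp; tauto
      · rw [disjoint_left]; intro j; simp; tauto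
    have e2 : #(S ∩ C) + #(Sᶜ ∩ C) = #C := by
      rw [← card_union_of_disjoint]
      · congr 1; ext j; simp; tauto
      · rw [disjoint_left]; intro j; simp; tauto
    have e3 : #(S ∩ (B ∪ C)) = #(S ∩ B) + #(S ∩ C) := by
      rw [← card_union_of_disjoint]
      · congr 1; ext j; simp; tauto
      · rw [disjoint_left]; intro j; have := h j; simp; tauto
    have e4 : #(Sᶜ \ B) + #(Sᶜ ∩ B) = #Sᶜ := card_sdiff_add_card_inter _ _
    have e5 : #(Sᶜ \ C) + #(Sᶜ ∩ C) = #Sᶜ := card_sdiff_add_card_inter _ _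
    have e6 : #(Sᶜ \ (B ∩ C)) = #(Sᶜ \ B) + #(Sᶜ \ C) := by
      rw [← card_union_of_disjoint]
      · congr 1; ext j; simp; tauto
      · rw [disjoint_left]; intro j; have := h j; simp; tauto
    omega
  · rintro ⟨⟨U, P⟩, ⟨V, T⟩⟩ hy
    simp only [coe_filter, Set.mem_ofPred_eq, mem_product, mem_sigma, mem_powerset] at hy
    obtain ⟨⟨⟨hU, hP⟩, hV, hT⟩, hc⟩ := hy
    simp only [goodPairs, coe_filter, mem_univ, true_and, Set.mem_ofPred_eq]
    have e1 : #(P ∪ (Sᶜ \ T)) = #P + #(Sᶜ \ T) := by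
      apply card_union_of_disjoint
      rw [disjoint_left]; intro j hj
      have := hU (hP hj)
      simp [this]
    have e2 : #((U \ P) ∪ (Sᶜ \ (V \ T))) = #(U \ P) + #(Sᶜ \ (V \ T)) := by
      apply card_union_of_disjoint
      rw [disjoint_left]; intro j hj
      have := hU (mem_sdiff.1 hj).1
      simp [this]
    have e3 := card_sdiff_add_card_eq_card hP
    have e4 := card_sdiff_add_card_eq_card hT
    have e5 := card_sdiff_add_card_eq_card (hT.trans hV)
    have e6 := card_sdiff_add_card_eq_card ((sdiff_subset (s := V) (t := T)).trans hV)
    refine ⟨by omega, by omega, fun j => ?_⟩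
    have a1 := @hU j
    have a2 := @hP j
    have a3 := @hV j
    have a4 := @hT j
    simp only [mem_union, mem_sdiff, mem_compl] at *
    tauto
  · rintro ⟨B, C⟩ hx
    simp only [goodPairs, coe_filter, mem_univ, true_and, Set.mem_ofPred_eq] at hx
    obtain ⟨-, -, h⟩ := hx
    simp only [Prod.mk.injEq]
    constructor <;> ext j <;> have := h j <;>
      simp only [mem_union, mem_sdiff, mem_compl, mem_inter] <;> tauto
  · rintro ⟨⟨U, P⟩, ⟨V, T⟩⟩ hy
    simp only [coe_filter, Set.mem_ofPred_eq, mem_product, mem_sigma, mem_powerset] at hy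
    obtain ⟨⟨⟨hU, hP⟩, hV, hT⟩, -⟩ := hy
    simp only [Prod.mk.injEq, Sigma.mk.injEq, heq_eq_eq]
    refine ⟨⟨?_, ?_⟩, ?_, ?_⟩ <;> ext j <;> have a1 := @hU j <;> have a2 := @hP j <;>
      have a3 := @hV j <;> have a4 := @hT j <;>
      clear hsum hsig hU hP hV hT <;>
      simp only [mem_union, mem_sdiff, mem_compl, mem_inter] at a3 ⊢ <;> grind

/-- The ±1 matrix with the given positions of positive entries in each row. -/
def signMatrix {m n : ℕ} (R : Fin m → Finset (Fin n)) : Matrix (Fin m) (Fin n) ℤ :=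
  fun i j => if j ∈ R i then 1 else -1

theorem signMatrix_injective {m n : ℕ} :
    Function.Injective (signMatrix : (Fin m → Finset (Fin n)) → _) := by
  intro R R' h
  ext i j
  have := congrFun (congrFun h i) j
  simp only [signMatrix] at this
  split_ifs at this <;> simp_all

theorem IsPM.exists_signMatrix {m n : ℕ} {M : Matrix (Fin m) (Fin n) ℤ} (h : IsPM M) :
    ∃ R, signMatrix R = M := by
  refine ⟨fun i => univ.filter fun j => M i j = 1, ?_⟩
  ext i j
  rcases h i j with h | h <;> simp [signMatrix, h]

theorem isPM_signMatrix {m n : ℕ} (R : Fin m → Finset (Fin n)) : IsPM (signMatrix R) := by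
  intro i j
  simp only [signMatrix]
  split_ifs <;> simp

theorem sum_signMatrix_row {m n : ℕ} (R : Fin m → Finset (Fin n)) (i : Fin m) :
    ∑ j, signMatrix R i j = 2 * #(R i) - n := by
  have h : ∀ j, signMatrix R i j = 2 * (if j ∈ R i then 1 else 0) - 1 := by
    intro j; simp only [signMatrix]; split_ifs <;> norm_num
  simp [h, Finset.sum_sub_distrib, mul_comm]

theorem signMatrix_mem_goodA_iff (k : ℕ) (R : Fin 3 → Finset (Fin (2 * k + 1))) :
    signMatrix R ∈ goodA 3 (2 * k + 1) ↔
      (#(R 0) = k ∨ #(R 0) = k + 1) ∧ (R 1, R 2) ∈ goodPairs k (R 0) := by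
  simp only [goodA, Set.mem_ofPred_eq, isPM_signMatrix, true_and, sum_signMatrix_row, goodPairs,
    mem_filter, mem_univ, Fin.sum_univ_three]
  have hrow : ∀ a : ℕ, |2 * (a : ℤ) - ((2 * k + 1 : ℕ) : ℤ)| ≤ 1 ↔ a = k ∨ a = k + 1 := by
    intro a; rw [abs_le]; push_cast; omega
  have hcol : ∀ j, |signMatrix R 0 j + signMatrix R 1 j + signMatrix R 2 j| ≤ 1 ↔
      ¬(j ∈ R 0 ∧ j ∈ R 1 ∧ j ∈ R 2) ∧ (j ∈ R 0 ∨ j ∈ R 1 ∨ j ∈ R 2) := by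
    intro j
    simp only [signMatrix]
    by_cases h0 : j ∈ R 0 <;> by_cases h1 : j ∈ R 1 <;> by_cases h2 : j ∈ R 2 <;>
      simp [h0, h1, h2]
  have hthree : (∀ i, #(R i) = k ∨ #(R i) = k + 1) ↔
      (#(R 0) = k ∨ #(R 0) = k + 1) ∧ (#(R 1) = k ∨ #(R 1) = k + 1) ∧
        (#(R 2) = k ∨ #(R 2) = k + 1) := by
    simp [Fin.forall_fin_succ]
  simp only [hrow, hthree, hcol, and_assoc]

theorem alpha_three_eq_sum (k : ℕ) :
    alpha 3 (2 * k + 1) =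
      ∑ S : Finset (Fin (2 * k + 1)) with #S = k ∨ #S = k + 1, #(goodPairs k S) := by
  rw [← Finset.card_sigma, alpha, ← Set.ncard_coe_finset]
  symm
  refine Set.ncard_congr (fun x _ => signMatrix ![x.1, x.2.1, x.2.2]) ?_ ?_ ?_
  · rintro ⟨S, B, C⟩ hx
    rw [signMatrix_mem_goodA_iff]
    simpa using hx
  · rintro ⟨S, B, C⟩ ⟨S', B', C'⟩ _ _ h
    have := signMatrix_injective h
    have h0 := congrFun this 0
    have h1 := congrFun this 1
    have h2 := congrFun this 2
    simp at h0 h1 h2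
    simp [h0, h1, h2]
  · intro M hM
    obtain ⟨R, rfl⟩ := IsPM.exists_signMatrix hM.1
    rw [signMatrix_mem_goodA_iff] at hM
    refine ⟨⟨R 0, R 1, R 2⟩, by simpa using hM, ?_⟩
    congr 1
    ext i : 1
    fin_cases i <;> rfl

theorem stmt4 (k : ℕ) :
    alpha 3 (2 * k + 1) =
      2 * Nat.choose (2 * k + 1) k *
        ∑ i ∈ Finset.range (k + 1),
          Nat.choose k i *
            (Nat.choose (2 * i + 1) (i + 1) * Nat.choose (k + 1) i +
              2 * Nat.choose (k + 1) (i + 1) * Nat.choose (2 * i + 1) i) := by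
  rw [alpha_three_eq_sum, ← sum_choose_ite_eq, Finset.filter_or, Finset.sum_union]
  · have hcompl : ∑ S : Finset (Fin (2 * k + 1)) with #S = k + 1, #(goodPairs k S) =
        ∑ S : Finset (Fin (2 * k + 1)) with #S = k, #(goodPairs k S) := by
      refine Finset.sum_nbij' compl compl ?_ ?_ ?_ ?_ ?_
      · intro S hS
        simp only [mem_filter, mem_univ, true_and, card_compl, Fintype.card_fin] at hS ⊢
        omega
      · intro S hS
        simp only [mem_filter, mem_univ, true_and, card_compl, Fintype.card_fin] at hS ⊢
        omega
      · simp
      · simp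
      · intro S _
        rw [card_goodPairs_compl]
    rw [hcompl, ← two_mul, mul_assoc]
    congr 1
    rw [Finset.sum_congr rfl fun S hS => card_goodPairs k S (mem_filter.1 hS).2,
      Finset.sum_const, smul_eq_mul]
    congr 1
    rw [Finset.univ_filter_card_eq, Finset.card_powersetCard, Finset.card_univ,
      Fintype.card_fin]
  · rw [disjoint_left]
    intro S h h'
    simp only [mem_filter, mem_univ, true_and] at h h'
    omega
end

section
/- For every positive integer n, α(4,n) = C(2⌈n/2⌉, ⌈n/2⌉) · Σ_{i=0}^{⌈n/2⌉} C(⌈n/2⌉, i)² · C(2i,i), where C(a,b) denotes the binomial coefficient. -/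
open Finset

/-- The ±1 vector that is `1` exactly on `S`. -/
def signVec {n : ℕ} (S : Finset (Fin n)) : Fin n → ℤ :=
  fun j => if j ∈ S then 1 else -1

lemma signVec_apply {n : ℕ} (S : Finset (Fin n)) (j : Fin n) :
    signVec S j = if j ∈ S then 1 else -1 := rfl

lemma signVec_filter {n : ℕ} (v : Fin n → ℤ) (hv : ∀ j, v j = 1 ∨ v j = -1) :
    signVec {j | v j = 1} = v := by
  ext j
  rcases hv j with h | h <;> simp [signVec, h]

lemma signVec_injective {n : ℕ} :
    Function.Injective (signVec : Finset (Fin n) → Fin n → ℤ) := by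
  intro S T h
  ext j
  have := congrFun h j
  by_cases hS : j ∈ S <;> by_cases hT : j ∈ T <;> simp_all [signVec]

lemma sum_signVec {n : ℕ} (S : Finset (Fin n)) : ∑ j, signVec S j = 2 * (#S : ℤ) - n := by
  have h (j : Fin n) : signVec S j = 2 * (if j ∈ S then 1 else 0) - 1 := by
    unfold signVec; split_ifs <;> norm_num
  simp [h, Finset.sum_sub_distrib, mul_comm]

lemma abs_sum_signVec_le_one_iff {k : ℕ} (S : Finset (Fin (2 * k))) :
    |∑ j, signVec S j| ≤ 1 ↔ #S = k := by
  rw [sum_signVec, abs_le]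
  push_cast
  omega

/-- The four rows with positive parts `R`, `(R \ X) ∪ Y`, and the two rows that complete them to
columns of sum zero, the third being positive on `Z` among the columns where the first two
rows differ. -/
def ofParts {n : ℕ}
    (t : Σ _ : Finset (Fin n), Σ _ : Finset (Fin n), Σ _ : Finset (Fin n), Finset (Fin n)) :
    Matrix (Fin 4) (Fin n) ℤ :=
  ![signVec t.1, signVec ((t.1 \ t.2.1) ∪ t.2.2.1),
    signVec ((t.1ᶜ \ t.2.2.1) ∪ t.2.2.2),
    signVec ((t.1ᶜ \ t.2.2.1) ∪ ((t.2.1 ∪ t.2.2.1) \ t.2.2.2))]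

/-- The parameters of the balanced matrices with four rows and `n` columns. -/
def balancedParts (n k : ℕ) : Finset
    (Σ _ : Finset (Fin n), Σ _ : Finset (Fin n), Σ _ : Finset (Fin n), Finset (Fin n)) :=
  (powersetCard k univ).sigma fun R => R.powerset.sigma fun X =>
    (powersetCard #X Rᶜ).sigma fun Y => powersetCard #X (X ∪ Y)

lemma mem_balancedParts {n k : ℕ} {R X Y Z : Finset (Fin n)} :
    (⟨R, X, Y, Z⟩ : Σ _ : Finset (Fin n), Σ _ : Finset (Fin n), Σ _ : Finset (Fin n),
      Finset (Fin n)) ∈ balancedParts n k ↔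
      #R = k ∧ X ⊆ R ∧ (Y ⊆ Rᶜ ∧ #Y = #X) ∧ Z ⊆ X ∪ Y ∧ #Z = #X := by
  simp [balancedParts, mem_powersetCard]

lemma card_balancedParts (k : ℕ) :
    #(balancedParts (2 * k) k) =
      (2 * k).choose k * ∑ i ∈ range (k + 1), k.choose i ^ 2 * (2 * i).choose i := by
  have inner : ∀ R ∈ powersetCard k (univ : Finset (Fin (2 * k))),
      #(R.powerset.sigma fun X => (powersetCard #X Rᶜ).sigma fun Y => powersetCard #X (X ∪ Y)) =
        ∑ i ∈ range (k + 1), k.choose i ^ 2 * (2 * i).choose i := by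
    intro R hR
    have hR : #R = k := (mem_powersetCard.1 hR).2
    have hRc : #Rᶜ = k := by rw [card_compl, Fintype.card_fin]; omega
    have fibre : ∀ X ∈ R.powerset,
        #((powersetCard #X Rᶜ).sigma fun Y => powersetCard #X (X ∪ Y)) =
          k.choose #X * (2 * #X).choose #X := by
      intro X hX
      rw [card_sigma, sum_const_nat (m := (2 * #X).choose #X), card_powersetCard, hRc]
      intro Y hY
      obtain ⟨hYR, hYX⟩ := mem_powersetCard.1 hY
      have hd : Disjoint X Y :=
        disjoint_of_subset_left (mem_powerset.1 hX)
          (disjoint_of_subset_right hYR disjoint_compl_right)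
      rw [card_powersetCard, card_union_of_disjoint hd, hYX, ← two_mul]
    rw [card_sigma, sum_congr rfl fibre,
      sum_powerset_apply_card (fun i => k.choose i * (2 * i).choose i), hR]
    refine sum_congr rfl fun i _ => ?_
    rw [smul_eq_mul]; ring
  rw [balancedParts, card_sigma, sum_const_nat inner, card_powersetCard, card_univ,
    Fintype.card_fin]

lemma ofParts_injOn (n k : ℕ) : Set.InjOn (ofParts (n := n)) ↑(balancedParts n k) := by
  rintro ⟨R, X, Y, Z⟩ h ⟨R', X', Y', Z'⟩ h' he
  rw [mem_coe, mem_balancedParts] at h h'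
  obtain ⟨-, hX, ⟨hY, -⟩, hZ, -⟩ := h
  obtain ⟨-, hX', ⟨hY', -⟩, hZ', -⟩ := h'
  have e0 : R = R' := signVec_injective (congrFun he 0)
  have e1 : (R \ X) ∪ Y = (R' \ X') ∪ Y' := signVec_injective (congrFun he 1)
  have e2 : (Rᶜ \ Y) ∪ Z = (R'ᶜ \ Y') ∪ Z' := signVec_injective (congrFun he 2)
  subst e0
  have eX : X = X' := by
    ext j
    have := congrArg (j ∈ ·) e1
    have := @hX j
    have := @hX' j
    have := @hY j
    have := @hY' j
    simp only [mem_union, mem_sdiff, mem_compl, eq_iff_iff] at *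
    tauto
  subst eX
  have eY : Y = Y' := by
    ext j
    have := congrArg (j ∈ ·) e1
    have := @hY j
    have := @hY' j
    simp only [mem_union, mem_sdiff, mem_compl, eq_iff_iff] at *
    tauto
  subst eY
  have eZ : Z = Z' := by
    ext j
    have := congrArg (j ∈ ·) e2
    have := @hZ j
    have := @hZ' j
    have := @hX j
    simp only [mem_union, mem_sdiff, mem_compl, eq_iff_iff] at *
    tauto
  subst eZ
  rfl

lemma ofParts_mem_goodA {k : ℕ}
    {t : Σ _ : Finset (Fin (2 * k)), Σ _ : Finset (Fin (2 * k)), Σ _ : Finset (Fin (2 * k)),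
      Finset (Fin (2 * k))} (ht : t ∈ balancedParts (2 * k) k) :
    ofParts t ∈ goodA 4 (2 * k) := by
  obtain ⟨R, X, Y, Z⟩ := t
  obtain ⟨hR, hX, ⟨hY, hYc⟩, hZ, hZc⟩ := mem_balancedParts.1 ht
  have hRc : #Rᶜ = k := by rw [card_compl, Fintype.card_fin]; omega
  have hXle := card_le_card hX
  have hXY : Disjoint X Y :=
    disjoint_of_subset_left hX (disjoint_of_subset_right hY disjoint_compl_right)
  have hd : Disjoint (Rᶜ \ Y) (X ∪ Y) := by
    rw [disjoint_left]
    intro j hj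
    have := @hX j
    simp only [mem_union, mem_sdiff, mem_compl] at *
    tauto
  refine ⟨?_, ?_, ?_⟩
  · intro i j
    fin_cases i <;> simp only [ofParts] <;> simp [signVec_apply] <;> tauto
  · intro i
    fin_cases i
    · exact (abs_sum_signVec_le_one_iff _).2 hR
    · refine (abs_sum_signVec_le_one_iff _).2 ?_
      rw [card_union_of_disjoint, card_sdiff_of_subset hX]
      · change #R - #X + #Y = k
        omega
      · exact disjoint_of_subset_left sdiff_subset
          (disjoint_of_subset_right hY disjoint_compl_right)
    · refine (abs_sum_signVec_le_one_iff _).2 ?_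
      rw [card_union_of_disjoint (disjoint_of_subset_right hZ hd), card_sdiff_of_subset hY]
      omega
    · refine (abs_sum_signVec_le_one_iff _).2 ?_
      rw [card_union_of_disjoint (disjoint_of_subset_right sdiff_subset hd),
        card_sdiff_of_subset hY, card_sdiff_of_subset hZ, card_union_of_disjoint hXY]
      omega
  · intro j
    have hXj := @hX j
    have hYj := @hY j
    have hZj := @hZ j
    simp only [mem_union, mem_compl] at hXj hYj hZj
    rw [Fin.sum_univ_four]
    simp only [ofParts]
    by_cases h0 : j ∈ R <;> by_cases h1 : j ∈ X <;> by_cases h2 : j ∈ Y <;>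
      by_cases h3 : j ∈ Z <;> simp_all [signVec_apply]

lemma goodA_subset_image_ofParts (k : ℕ) :
    goodA 4 (2 * k) ⊆ ofParts '' ↑(balancedParts (2 * k) k) := by
  rintro M ⟨hM, hrow, hcol⟩
  have hsum (j : Fin (2 * k)) : |M 0 j + M 1 j + M 2 j + M 3 j| ≤ 1 := by
    simpa [Fin.sum_univ_four] using hcol j
  set P : Fin 4 → Finset (Fin (2 * k)) := fun i => {j | M i j = 1} with hP
  have hmem (i j) : j ∈ P i ↔ M i j = 1 := by simp [hP]
  have hcard (i) : #(P i) = k := by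
    rw [← abs_sum_signVec_le_one_iff, hP, signVec_filter _ (hM i)]
    exact hrow i
  have hdiff : #(P 1 \ P 0) = #(P 0 \ P 1) :=
    card_sdiff_comm ((hcard 1).trans (hcard 0).symm)
  refine ⟨⟨P 0, P 0 \ P 1, P 1 \ P 0, P 2 ∩ ((P 0 \ P 1) ∪ (P 1 \ P 0))⟩, ?_, ?_⟩
  · rw [mem_coe, mem_balancedParts]
    refine ⟨hcard 0, sdiff_subset, ⟨fun j hj => ?_, hdiff⟩, inter_subset_right, ?_⟩
    · simp only [mem_sdiff, mem_compl] at *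
      exact hj.2
    · have hunion : P 2 = (P 0 ∪ P 1)ᶜ ∪ P 2 ∩ ((P 0 \ P 1) ∪ (P 1 \ P 0)) := by
        ext j
        have := hsum j
        simp only [mem_union, mem_inter, mem_sdiff, mem_compl, hmem]
        rcases hM 0 j with h0 | h0 <;> rcases hM 1 j with h1 | h1 <;>
          rcases hM 2 j with h2 | h2 <;> rcases hM 3 j with h3 | h3 <;> simp_all
      have hdisj : Disjoint (P 0 ∪ P 1)ᶜ (P 2 ∩ ((P 0 \ P 1) ∪ (P 1 \ P 0))) := by
        rw [disjoint_left]
        intro j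
        simp only [mem_union, mem_inter, mem_sdiff, mem_compl]
        tauto
      have hc := congrArg card hunion
      rw [card_union_of_disjoint hdisj, card_compl, Fintype.card_fin, hcard 2] at hc
      have h01 := card_sdiff_add_card (P 0) (P 1)
      have hle := card_le_univ (P 0 ∪ P 1)
      rw [Fintype.card_fin] at hle
      rw [hcard 1] at h01
      omega
  · ext i j
    have := hsum j
    fin_cases i <;> simp only [ofParts] <;>
      rcases hM 0 j with h0 | h0 <;> rcases hM 1 j with h1 | h1 <;>
        rcases hM 2 j with h2 | h2 <;> rcases hM 3 j with h3 | h3 <;> simp_all [signVec_apply]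

theorem alpha_four_two_mul (k : ℕ) :
    alpha 4 (2 * k) =
      (2 * k).choose k * ∑ i ∈ range (k + 1), k.choose i ^ 2 * (2 * i).choose i := by
  have himage : goodA 4 (2 * k) = ofParts '' ↑(balancedParts (2 * k) k) :=
    (goodA_subset_image_ofParts k).antisymm (Set.image_subset_iff.2 fun _ ht =>
      ofParts_mem_goodA ht)
  rw [alpha, himage, (ofParts_injOn _ _).ncard_image, Set.ncard_coe_finset,
    card_balancedParts]

lemma sum_row_eq_zero {m k : ℕ} {M : Matrix (Fin m) (Fin (2 * k)) ℤ}
    (hM : M ∈ goodA m (2 * k)) (i : Fin m) : ∑ j, M i j = 0 := by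
  have h := hM.2.1 i
  rw [← signVec_filter (M i) (hM.1 i)] at h ⊢
  rw [sum_signVec, (abs_sum_signVec_le_one_iff _).1 h]
  push_cast
  ring

lemma sum_row_eq_one_or_neg_one {m k : ℕ} {M : Matrix (Fin m) (Fin (2 * k + 1)) ℤ}
    (hM : M ∈ goodA m (2 * k + 1)) (i : Fin m) : ∑ j, M i j = 1 ∨ ∑ j, M i j = -1 := by
  have h := hM.2.1 i
  rw [← signVec_filter (M i) (hM.1 i), sum_signVec, abs_le] at *
  push_cast at *
  omega

lemma sum_col_eq_zero {n : ℕ} {M : Matrix (Fin 4) (Fin n) ℤ}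
    (hM : M ∈ goodA 4 n) (j : Fin n) : ∑ i, M i j = 0 := by
  have h := hM.2.2 j
  rw [Fin.sum_univ_four] at *
  rcases hM.1 0 j with h0 | h0 <;> rcases hM.1 1 j with h1 | h1 <;>
    rcases hM.1 2 j with h2 | h2 <;> rcases hM.1 3 j with h3 | h3 <;> simp_all

/-- Deleting the last column is a bijection from `A(4, 2k + 2)` to `A(4, 2k + 1)`. -/
theorem alpha_four_odd (k : ℕ) : alpha 4 (2 * k + 1) = alpha 4 (2 * (k + 1)) := by
  let del : Matrix (Fin 4) (Fin (2 * (k + 1))) ℤ → Matrix (Fin 4) (Fin (2 * k + 1)) ℤ :=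
    fun M i j => M i j.castSucc
  have hlast {M : Matrix (Fin 4) (Fin (2 * (k + 1))) ℤ} (hM : M ∈ goodA 4 (2 * (k + 1)))
      (i : Fin 4) : ∑ j, del M i j = -M i (Fin.last (2 * k + 1)) := by
    have h := sum_row_eq_zero hM i
    have h' := Fin.sum_univ_castSucc (n := 2 * k + 1) (M i)
    exact eq_neg_of_add_eq_zero_left (h'.symm.trans h)
  have hinj : Set.InjOn del (goodA 4 (2 * (k + 1))) := by
    intro M hM M' hM' h
    ext i j
    refine Fin.lastCases (n := 2 * k + 1) ?_ (fun j => ?_) j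
    · have h' := hlast hM i
      rw [h, hlast hM' i] at h'
      exact (neg_injective h').symm
    · exact congrFun (congrFun h i) j
  have himage : goodA 4 (2 * k + 1) = del '' goodA 4 (2 * (k + 1)) := by
    apply Set.Subset.antisymm
    · intro M hM
      obtain ⟨E, hl, hc⟩ : ∃ E : Matrix (Fin 4) (Fin (2 * (k + 1))) ℤ,
          (∀ i, E i (Fin.last (2 * k + 1)) = -∑ j, M i j) ∧
            ∀ i (j : Fin (2 * k + 1)), E i j.castSucc = M i j :=
        ⟨fun i => Fin.snoc (n := 2 * k + 1) (α := fun _ => ℤ) (fun j => M i j) (-∑ j, M i j),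
          fun i => Fin.snoc_last (α := fun _ => ℤ) _ _,
          fun i j => Fin.snoc_castSucc (α := fun _ => ℤ) _ _ _⟩
      refine ⟨E, ⟨fun i j => ?_, fun i => ?_, fun j => ?_⟩, funext fun i => funext (hc i)⟩
      · refine Fin.lastCases (n := 2 * k + 1) ?_ (fun j => ?_) j
        · rw [hl]
          rcases sum_row_eq_one_or_neg_one hM i with h | h <;> simp [h]
        · rw [hc]
          exact hM.1 i j
      · have h : ∑ j, E i j = 0 := by
          refine (Fin.sum_univ_castSucc (n := 2 * k + 1) (E i)).trans ?_
          simp [hl, hc]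
        simp [h]
      · refine Fin.lastCases (n := 2 * k + 1) ?_ (fun j => ?_) j
        · have h : ∑ i, ∑ j, M i j = 0 :=
            sum_comm.trans (sum_eq_zero fun j _ => sum_col_eq_zero hM j)
          have h' : ∑ i, E i (Fin.last (2 * k + 1)) = 0 := by
            rw [sum_congr rfl fun i _ => hl i, sum_neg_distrib, h, neg_zero]
          exact (congrArg abs h').le.trans (by simp)
        · simp only [hc]
          exact hM.2.2 j
    · rintro _ ⟨M, hM, rfl⟩
      refine ⟨fun i j => hM.1 i _, fun i => ?_, fun j => hM.2.2 _⟩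
      rw [hlast hM]
      rcases hM.1 i (Fin.last (2 * k + 1)) with h | h <;> simp [h]
  rw [alpha, alpha, himage, hinj.ncard_image]

theorem stmt5 (n : ℕ) (hn : 0 < n) :
    alpha 4 n =
      Nat.choose (2 * ((n + 1) / 2)) ((n + 1) / 2) *
        ∑ i ∈ Finset.range ((n + 1) / 2 + 1),
          (Nat.choose ((n + 1) / 2) i) ^ 2 * Nat.choose (2 * i) i := by
  rcases Nat.even_or_odd' n with ⟨k, rfl | rfl⟩
  · rw [show (2 * k + 1) / 2 = k by omega, alpha_four_two_mul]
  · rw [show (2 * k + 1 + 1) / 2 = k + 1 by omega, alpha_four_odd, alpha_four_two_mul]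
end

section
/- For every positive integer n, α(3,n) equals the number of n-step walks on the cubic lattice ℤ³ that start at the origin, use unit steps from {(1,0,0),(-1,0,0),(0,1,0),(0,-1,0),(0,0,1),(0,0,-1)}, and end at the origin if n is even, or end at one of the eight points {(1,0,0),(-1,0,0),(0,1,0),(0,-1,0),(0,0,1),(0,0,-1),(1,1,1),(-1,-1,-1)} if n is odd. (Equivalently, α(3,n) equals the number of sequences of n steps from the six unit vectors in ℤ³ whose sum lies in the indicated set.) -/
open Finset

/-- The six unit steps of the cubic lattice `ℤ³`. -/
def unitSteps : Set (ℤ × ℤ × ℤ) :=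
  {(1, 0, 0), (-1, 0, 0), (0, 1, 0), (0, -1, 0), (0, 0, 1), (0, 0, -1)}

/-- The matrix whose `j`-th column is the image of the step `w j` under the linear map
`(x, y, z) ↦ (y + z - x, x + z - y, x + y - z)`. -/
def walkMatrix {n : ℕ} (w : Fin n → ℤ × ℤ × ℤ) : Matrix (Fin 3) (Fin n) ℤ :=
  fun i j => ![(w j).2.1 + (w j).2.2 - (w j).1, (w j).1 + (w j).2.2 - (w j).2.1,
    (w j).1 + (w j).2.1 - (w j).2.2] i

theorem walkMatrix_injective (n : ℕ) : Function.Injective (walkMatrix (n := n)) := by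
  intro v w h
  funext j
  have h0 := congrFun (congrFun h 0) j
  have h1 := congrFun (congrFun h 1) j
  have h2 := congrFun (congrFun h 2) j
  simp only [walkMatrix, Fin.isValue, Matrix.cons_val_zero, Matrix.cons_val_one,
    Matrix.cons_val] at h0 h1 h2
  ext <;> omega

theorem mem_unitSteps_iff (x y z : ℤ) :
    (x, y, z) ∈ unitSteps ↔
      ((y + z - x = 1 ∨ y + z - x = -1) ∧ (x + z - y = 1 ∨ x + z - y = -1) ∧
        (x + y - z = 1 ∨ x + y - z = -1)) ∧ |x + y + z| ≤ 1 := by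
  simp only [unitSteps, Set.mem_insert_iff, Set.mem_singleton_iff, Prod.mk.injEq, abs_le]
  omega

/-- The coordinate sum of the endpoint of a walk has the parity of its length. -/
theorem two_dvd_endpoint_sub_length {n : ℕ} {w : Fin n → ℤ × ℤ × ℤ}
    (hw : ∀ j, w j ∈ unitSteps) :
    (2 : ℤ) ∣ (∑ j, w j).1 + (∑ j, w j).2.1 + (∑ j, w j).2.2 - n := by
  have h : (2 : ℤ) ∣ ∑ j, ((w j).1 + (w j).2.1 + (w j).2.2 - 1) := by
    refine Finset.dvd_sum fun j _ => ?_
    have := (mem_unitSteps_iff (w j).1 (w j).2.1 (w j).2.2).1 (hw j)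
    omega
  simpa [Finset.sum_add_distrib, Finset.sum_sub_distrib, Prod.fst_sum, Prod.snd_sum] using h

theorem endpoint_iff {n : ℕ} {x y z : ℤ} (h : (2 : ℤ) ∣ x + y + z - n) :
    ((Even n ∧ (x, y, z) = 0) ∨
      (Odd n ∧ (x, y, z) ∈
        ({(1, 0, 0), (-1, 0, 0), (0, 1, 0), (0, -1, 0), (0, 0, 1), (0, 0, -1),
          (1, 1, 1), (-1, -1, -1)} : Set (ℤ × ℤ × ℤ)))) ↔
      |y + z - x| ≤ 1 ∧ |x + z - y| ≤ 1 ∧ |x + y - z| ≤ 1 := by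
  simp only [Set.mem_insert_iff, Set.mem_singleton_iff, Prod.mk.injEq, Prod.mk_eq_zero]
  constructor
  · rintro (⟨-, rfl, rfl, rfl⟩ | ⟨-, hx⟩)
    · decide
    · rcases hx with h | h | h | h | h | h | h | h <;> obtain ⟨rfl, rfl, rfl⟩ := h <;> decide
  · simp only [abs_le]
    rintro ⟨hx, hy, hz⟩
    rcases Nat.even_or_odd n with hn | hn
    · have hn' := Nat.even_iff.1 hn
      exact Or.inl ⟨hn, by omega, by omega, by omega⟩
    · have hn' := Nat.odd_iff.1 hn
      have hx : y + z - x = 1 ∨ y + z - x = -1 := by omega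
      have hy : x + z - y = 1 ∨ x + z - y = -1 := by omega
      have hz : x + y - z = 1 ∨ x + y - z = -1 := by omega
      clear h hn'
      refine Or.inr ⟨hn, ?_⟩
      rcases hx with hx | hx <;> rcases hy with hy | hy <;> rcases hz with hz | hz <;> omega

theorem walkMatrix_mem_goodA_iff {n : ℕ} (w : Fin n → ℤ × ℤ × ℤ) :
    walkMatrix w ∈ goodA 3 n ↔
      (∀ j, w j ∈ unitSteps) ∧
        ((Even n ∧ ∑ j, w j = 0) ∨
          (Odd n ∧ ∑ j, w j ∈
            ({(1, 0, 0), (-1, 0, 0), (0, 1, 0), (0, -1, 0), (0, 0, 1), (0, 0, -1),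
              (1, 1, 1), (-1, -1, -1)} : Set (ℤ × ℤ × ℤ)))) := by
  have hcol : (∀ j, w j ∈ unitSteps) ↔
      IsPM (walkMatrix w) ∧ ∀ j, |∑ i, walkMatrix w i j| ≤ 1 := by
    rw [IsPM, forall_comm, ← forall_and]
    refine forall_congr' fun j => (mem_unitSteps_iff (w j).1 (w j).2.1 (w j).2.2).trans ?_
    have hs : ∑ i, walkMatrix w i j = (w j).1 + (w j).2.1 + (w j).2.2 := by
      simp only [Fin.sum_univ_three, walkMatrix, Fin.isValue, Matrix.cons_val_zero,
        Matrix.cons_val_one, Matrix.cons_val]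
      ring
    rw [hs, Fin.forall_fin_succ, Fin.forall_fin_two]
    rfl
  have hrow (h : ∀ j, w j ∈ unitSteps) :=
    endpoint_iff (two_dvd_endpoint_sub_length h)
  have hrows : (∀ i, |∑ j, walkMatrix w i j| ≤ 1) ↔
      |(∑ j, w j).2.1 + (∑ j, w j).2.2 - (∑ j, w j).1| ≤ 1 ∧
      |(∑ j, w j).1 + (∑ j, w j).2.2 - (∑ j, w j).2.1| ≤ 1 ∧
      |(∑ j, w j).1 + (∑ j, w j).2.1 - (∑ j, w j).2.2| ≤ 1 := by
    rw [Fin.forall_fin_succ, Fin.forall_fin_two]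
    simp [walkMatrix, Prod.fst_sum, Prod.snd_sum, Finset.sum_add_distrib, Finset.sum_sub_distrib]
  constructor
  · rintro ⟨hpm, hr, hc⟩
    have hu := hcol.2 ⟨hpm, hc⟩
    exact ⟨hu, (hrow hu).2 (hrows.1 hr)⟩
  · rintro ⟨hu, he⟩
    exact ⟨(hcol.1 hu).1, hrows.2 ((hrow hu).1 he), (hcol.1 hu).2⟩

theorem exists_walkMatrix_eq {n : ℕ} {M : Matrix (Fin 3) (Fin n) ℤ} (hM : IsPM M) :
    ∃ w, walkMatrix w = M := by
  refine ⟨fun j => ((M 1 j + M 2 j) / 2, (M 0 j + M 2 j) / 2, (M 0 j + M 1 j) / 2), ?_⟩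
  ext i j
  have h0 := hM 0 j
  have h1 := hM 1 j
  have h2 := hM 2 j
  fin_cases i <;>
    simp only [walkMatrix, Fin.zero_eta, Fin.mk_one, Fin.reduceFinMk, Fin.isValue,
      Matrix.cons_val_zero, Matrix.cons_val_one, Matrix.cons_val] <;>
    omega

theorem stmt6 (n : ℕ) (hn : 0 < n) :
    alpha 3 n =
      Set.ncard {w : Fin n → ℤ × ℤ × ℤ |
        (∀ i, w i ∈ ({(1, 0, 0), (-1, 0, 0), (0, 1, 0), (0, -1, 0), (0, 0, 1), (0, 0, -1)} :
          Set (ℤ × ℤ × ℤ))) ∧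
        ((Even n ∧ ∑ i, w i = 0) ∨
          (Odd n ∧ ∑ i, w i ∈
            ({(1, 0, 0), (-1, 0, 0), (0, 1, 0), (0, -1, 0), (0, 0, 1), (0, 0, -1),
              (1, 1, 1), (-1, -1, -1)} : Set (ℤ × ℤ × ℤ))))} := by
  refine (Set.ncard_congr (fun w _ => walkMatrix w)
    (fun w hw => (walkMatrix_mem_goodA_iff w).2 hw)
    (fun _ _ _ _ h => walkMatrix_injective n h) fun M hM => ?_).symm
  obtain ⟨w, rfl⟩ := exists_walkMatrix_eq hM.1
  exact ⟨w, (walkMatrix_mem_goodA_iff w).1 hM, rfl⟩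
end

section
/- Let m be even and n be any positive integer. Let r = (r₁,…,r_{m-1}) ∈ ℤ^{m-1} and let r⁺ = (r₁,…,r_{m-1}, -Σ_{i=1}^{m-1} r_i) ∈ ℤ^m be its extension whose last entry is the negative of the sum of all the previous entries. Then α_r(m-1,n) = α_{r⁺}(m,n). -/
open Finset

/-- `Ar m n r` is the set A_r(m,n) of m×n ±1 matrices whose column sums all have
absolute value at most 1 and whose row-sum vector equals `r`. -/
def Ar (m n : ℕ) (r : Fin m → ℤ) : Set (Matrix (Fin m) (Fin n) ℤ) :=
  {M | IsPM M ∧ (∀ j, |∑ i, M i j| ≤ 1) ∧ (∀ i, ∑ j, M i j = r i)}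

/-- `alphaR m n r = |A_r(m,n)|`. -/
noncomputable def alphaR (m n : ℕ) (r : Fin m → ℤ) : ℕ := (Ar m n r).ncard

/-- The sum of a finite family of `±1` integers has the parity of the number of terms. -/
theorem even_sum_pm_one_sub_card {m : ℕ} (f : Fin m → ℤ) (hf : ∀ i, f i = 1 ∨ f i = -1) :
    Even (∑ i, f i - m) := by
  have h : ∑ i, f i - (m : ℤ) = ∑ i, (f i - 1) := by simp [Finset.sum_sub_distrib]
  rw [h]
  refine Finset.even_sum _ fun i _ => ?_
  rcases hf i with h | h <;> rw [h] <;> decide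

/-- Append to a matrix the row making every column sum vanish. -/
def appendBalancingRow {k n : ℕ} (M : Matrix (Fin k) (Fin n) ℤ) :
    Matrix (Fin (k + 1)) (Fin n) ℤ :=
  fun i j => Fin.snoc (α := fun _ => ℤ) (fun i => M i j) (-∑ i, M i j) i

@[simp]
theorem appendBalancingRow_castSucc {k n : ℕ} (M : Matrix (Fin k) (Fin n) ℤ) (i : Fin k)
    (j : Fin n) : appendBalancingRow M i.castSucc j = M i j := by
  simp [appendBalancingRow]

@[simp]
theorem appendBalancingRow_last {k n : ℕ} (M : Matrix (Fin k) (Fin n) ℤ) (j : Fin n) :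
    appendBalancingRow M (Fin.last k) j = -∑ i, M i j := by
  simp [appendBalancingRow]

theorem appendBalancingRow_injective {k n : ℕ} :
    Function.Injective (appendBalancingRow (k := k) (n := n)) := by
  intro M N h
  ext i j
  simpa using congrFun (congrFun h i.castSucc) j

theorem Ar_snoc_eq_image {k n : ℕ} (hk : Even (k + 1)) (r : Fin k → ℤ) :
    Ar (k + 1) n (Fin.snoc r (-∑ i, r i)) = appendBalancingRow '' Ar k n r := by
  obtain ⟨c, hc⟩ := hk
  ext N
  constructor
  · rintro ⟨hpm, hcol, hrow⟩
    have hzero (j) : ∑ i, N i j = 0 := by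
      obtain ⟨d, hd⟩ := even_sum_pm_one_sub_card (fun i => N i j) (fun i => hpm i j)
      have := abs_le.mp (hcol j)
      push_cast at hd
      omega
    have hlast (j) : N (Fin.last k) j = -∑ i : Fin k, N i.castSucc j := by
      have := hzero j
      rw [Fin.sum_univ_castSucc] at this
      linarith
    refine ⟨fun i j => N i.castSucc j, ⟨fun i j => hpm _ j, fun j => ?_, fun i => ?_⟩, ?_⟩
    · have := hlast j
      rcases hpm (Fin.last k) j with h | h <;> rw [abs_le] <;> constructor <;> linarith
    · simpa using hrow i.castSucc
    · ext i j
      refine Fin.lastCases ?_ (fun i => ?_) i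
      · exact (appendBalancingRow_last _ j).trans (hlast j).symm
      · exact appendBalancingRow_castSucc _ i j
  · rintro ⟨M, ⟨hpm, hcol, hrow⟩, rfl⟩
    refine ⟨fun i j => ?_, fun j => ?_, fun i => ?_⟩
    · refine Fin.lastCases ?_ (fun i => ?_) i
      · obtain ⟨d, hd⟩ := even_sum_pm_one_sub_card (fun i => M i j) (fun i => hpm i j)
        have := abs_le.mp (hcol j)
        rw [appendBalancingRow_last]
        omega
      · simpa using hpm i j
    · simp [Fin.sum_univ_castSucc]
    · refine Fin.lastCases ?_ (fun i => ?_) i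
      · simp only [appendBalancingRow_last, Fin.snoc_last, Finset.sum_neg_distrib]
        rw [Finset.sum_comm]
        simp [hrow]
      · simpa using hrow i

theorem stmt7 (k n : ℕ) (hm : Even (k + 1)) (hn : 0 < n) (r : Fin k → ℤ) :
    alphaR k n r = alphaR (k + 1) n (Fin.snoc r (-∑ i, r i)) := by
  rw [alphaR, alphaR, Ar_snoc_eq_image hm,
    Set.ncard_image_of_injective _ appendBalancingRow_injective]
end

section
/- Let m be even and n be any positive integer. Then α(m,n) equals the number of matrices M in A(m-1,n) such that the sum of all entries of M (equivalently, the sum of all entries of its row-sum vector) is 0, 1, or -1. -/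
open Finset

/-- A sum of `m` signs has the same parity as `m`. -/
theorem two_dvd_sum_signs_sub {m : ℕ} {f : Fin m → ℤ} (hf : ∀ i, f i = 1 ∨ f i = -1) :
    (2 : ℤ) ∣ (∑ i, f i) - m := by
  have h : (∑ i, f i) - m = ∑ i, (f i - 1) := by simp
  rw [h]
  refine Finset.dvd_sum fun i _ => ?_
  rcases hf i with h | h <;> rw [h] <;> norm_num

/-- Append to `M` the row that makes every column sum zero. -/
def appendNegColSum {k n : ℕ} (M : Matrix (Fin k) (Fin n) ℤ) : Matrix (Fin (k + 1)) (Fin n) ℤ :=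
  Matrix.of fun i j => Fin.lastCases (motive := fun _ => ℤ) (-∑ i, M i j) (fun i => M i j) i

@[simp]
theorem appendNegColSum_castSucc {k n : ℕ} (M : Matrix (Fin k) (Fin n) ℤ) (i : Fin k) (j : Fin n) :
    appendNegColSum M i.castSucc j = M i j := by
  simp [appendNegColSum]

@[simp]
theorem appendNegColSum_last {k n : ℕ} (M : Matrix (Fin k) (Fin n) ℤ) (j : Fin n) :
    appendNegColSum M (Fin.last k) j = -∑ i, M i j := by
  simp [appendNegColSum]

theorem appendNegColSum_injective {k n : ℕ} :
    Function.Injective (appendNegColSum : Matrix (Fin k) (Fin n) ℤ → _) := by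
  intro M N h
  ext i j
  simpa using congrFun (congrFun h i.castSucc) j

theorem appendNegColSum_mem_goodA_iff {k n : ℕ} (hm : Even (k + 1))
    (M : Matrix (Fin k) (Fin n) ℤ) :
    appendNegColSum M ∈ goodA (k + 1) n ↔ M ∈ goodA k n ∧
      (∑ i, ∑ j, M i j = 0 ∨ ∑ i, ∑ j, M i j = 1 ∨ ∑ i, ∑ j, M i j = -1) := by
  have total : |∑ i, ∑ j, M i j| ≤ 1 ↔
      (∑ i, ∑ j, M i j = 0 ∨ ∑ i, ∑ j, M i j = 1 ∨ ∑ i, ∑ j, M i j = -1) := by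
    rw [abs_le]
    omega
  have comm : ∑ j, ∑ i, M i j = ∑ i, ∑ j, M i j := Finset.sum_comm
  simp only [goodA, Set.mem_ofPred_eq, IsPM, Fin.forall_fin_succ', Fin.sum_univ_castSucc,
    appendNegColSum_castSucc, appendNegColSum_last, Finset.sum_neg_distrib, abs_neg, comm,
    ← total]
  constructor
  · rintro ⟨⟨hM, hlast⟩, ⟨hrow, htot⟩, -⟩
    refine ⟨⟨hM, hrow, fun j => ?_⟩, htot⟩
    rw [abs_le]
    have := hlast j
    omega
  · rintro ⟨⟨hM, hrow, hcol⟩, htot⟩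
    refine ⟨⟨hM, fun j => ?_⟩, ⟨hrow, htot⟩, fun j => by simp⟩
    have hpar := two_dvd_sum_signs_sub fun i => hM i j
    have hj := abs_le.mp (hcol j)
    obtain ⟨r, hr⟩ := hm
    omega

theorem goodA_succ_subset_range {k n : ℕ} (hm : Even (k + 1)) :
    goodA (k + 1) n ⊆ Set.range appendNegColSum := by
  rintro M ⟨hM, -, hcol⟩
  refine ⟨M.submatrix Fin.castSucc id, ?_⟩
  ext i j
  induction i using Fin.lastCases with
  | cast i => simp
  | last =>
    have hpar := two_dvd_sum_signs_sub fun i => hM i j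
    have hj := abs_le.mp (hcol j)
    rw [Fin.sum_univ_castSucc] at hpar hj
    simp only [appendNegColSum_last, Matrix.submatrix_apply, id]
    obtain ⟨r, hr⟩ := hm
    omega

theorem stmt8 (k n : ℕ) (hm : Even (k + 1)) (hn : 0 < n) :
    alpha (k + 1) n =
      Set.ncard {M : Matrix (Fin k) (Fin n) ℤ | M ∈ goodA k n ∧
        (∑ i, ∑ j, M i j = 0 ∨ ∑ i, ∑ j, M i j = 1 ∨ ∑ i, ∑ j, M i j = -1)} := by
  rw [alpha, ← Set.image_preimage_eq_of_subset (goodA_succ_subset_range hm),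
    Set.ncard_image_of_injective _ appendNegColSum_injective]
  congr 1
  ext M
  exact appendNegColSum_mem_goodA_iff hm M
end

section
/- For every positive integer k, α(4,2k) = α(4,2k-1) = α(3,2k) = C(2k,k) · Σ_{i=0}^{k} C(k,i)² · C(2i,i), where C(a,b) denotes the binomial coefficient. -/
open Finset

theorem sum_eq_of_pm {ι : Type*} [Fintype ι] (f : ι → ℤ) (hf : ∀ i, f i = 1 ∨ f i = -1) :
    ∑ i, f i = 2 * (#{i | f i = 1} : ℤ) - Fintype.card ι := by
  have h : ∀ i, f i = 2 * (if f i = 1 then 1 else 0) - 1 := fun i => by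
    rcases hf i with h | h <;> simp [h]
  rw [Finset.sum_congr rfl fun i _ => h i, Finset.sum_sub_distrib, ← Finset.mul_sum]
  simp

theorem sum_eq_zero_of_pm {n : ℕ} (hn : Even n) (f : Fin n → ℤ) (hf : ∀ i, f i = 1 ∨ f i = -1)
    (h : |∑ i, f i| ≤ 1) : ∑ i, f i = 0 := by
  obtain ⟨a, rfl⟩ := hn
  have := sum_eq_of_pm f hf
  rw [Fintype.card_fin] at this
  rw [abs_le] at h
  push_cast at this
  omega

theorem sum_eq_one_or_of_pm {n : ℕ} (hn : Odd n) (f : Fin n → ℤ) (hf : ∀ i, f i = 1 ∨ f i = -1)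
    (h : |∑ i, f i| ≤ 1) : ∑ i, f i = 1 ∨ ∑ i, f i = -1 := by
  obtain ⟨a, rfl⟩ := hn
  have := sum_eq_of_pm f hf
  rw [Fintype.card_fin] at this
  rw [abs_le] at h
  push_cast at this
  omega

/-- Deleting the last column is a bijection from `goodA m (n + 1)` to `goodA m n`. -/
theorem alpha_succ_of_even_of_odd {m n : ℕ} (hm : Even m) (hn : Odd n) :
    alpha m (n + 1) = alpha m n := by
  have row_sum : ∀ M ∈ goodA m (n + 1), ∀ i,
      M i (Fin.last n) = -∑ j : Fin n, M i j.castSucc := by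
    rintro M ⟨h, hr, -⟩ i
    have := sum_eq_zero_of_pm hn.add_one _ (h i) (hr i)
    rw [Fin.sum_univ_castSucc] at this
    linarith
  refine Set.ncard_congr (fun M _ => Matrix.of fun i (j : Fin n) => M i j.castSucc) ?_ ?_ ?_
  · intro M hM
    refine ⟨fun i j => hM.1 i _, fun i => ?_, fun j => hM.2.2 _⟩
    have h := row_sum M hM i
    have : ∑ j : Fin n, M i j.castSucc = -M i (Fin.last n) := by linarith
    simp only [Matrix.of_apply, this]
    rcases hM.1 i (Fin.last n) with h | h <;> simp [h]
  · intro M N hM hN h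
    have h' : ∀ i (j : Fin n), M i j.castSucc = N i j.castSucc := fun i j =>
      congrFun (congrFun h i) j
    ext i j
    refine Fin.lastCases ?_ (fun j => h' i j) j
    rw [row_sum M hM, row_sum N hN]
    simp [h']
  · rintro N ⟨h, hr, hc⟩
    refine ⟨Matrix.of fun i => Fin.snoc (α := fun _ => ℤ) (N i) (-∑ j, N i j),
      ⟨fun i j => ?_, fun i => ?_, fun j => ?_⟩, ?_⟩
    · refine Fin.lastCases ?_ (fun j => ?_) j
      · have := sum_eq_one_or_of_pm hn _ (h i) (hr i)
        simp only [Matrix.of_apply, Fin.snoc_last]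
        omega
      · simpa using h i j
    · simp [Fin.sum_univ_castSucc]
    · refine Fin.lastCases ?_ (fun j => ?_) j
      · have : ∑ i, ∑ j, N i j = 0 := by
          refine Finset.sum_comm.trans ?_
          exact Finset.sum_eq_zero fun j _ => sum_eq_zero_of_pm hm _ (fun i => h i j) (hc j)
        simp [this]
      · simpa using hc j
    · ext i j
      simp

section Counting

variable {ι : Type*} [Fintype ι] [DecidableEq ι]

theorem card_filter_third {k : ℕ} (hι : Fintype.card ι = 2 * k) {R S : Finset ι} (hR : #R = k)
    (hS : #S = k) :
    #{T : Finset ι | #T = k ∧ ∀ x, ¬(x ∈ R ∧ x ∈ S ∧ x ∈ T) ∧ (x ∈ R ∨ x ∈ S ∨ x ∈ T)} =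
      (2 * #(R \ S)).choose #(R \ S) := by
  have h1 : #(R \ S) + #(R ∩ S) = k := by rw [card_sdiff_add_card_inter, hR]
  have h2 : #(S \ R) + #(R ∩ S) = k := by rw [inter_comm, card_sdiff_add_card_inter, hS]
  have h3 : #(R ∪ S) + #(R ∩ S) = k + k := by rw [card_union_add_card_inter, hR, hS]
  have h4 : #(R ∪ S) + #(R ∪ S)ᶜ = 2 * k := by rw [card_add_card_compl, hι]
  have h5 : #((R \ S) ∪ (S \ R)) = 2 * #(R \ S) := by
    rw [card_union_of_disjoint disjoint_sdiff_sdiff]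
    omega
  rw [← h5, ← card_powersetCard]
  refine Finset.card_nbij' (fun T => T \ (R ∪ S)ᶜ) (fun U => U ∪ (R ∪ S)ᶜ) ?_ ?_ ?_ ?_
  · intro T hT
    simp only [coe_filter, mem_univ, true_and, Set.mem_ofPred_eq] at hT
    have hsub : (R ∪ S)ᶜ ⊆ T := by
      intro x hx
      have := hT.2 x
      simp only [mem_compl, mem_union] at hx
      tauto
    simp only [mem_coe, mem_powersetCard]
    refine ⟨fun x hx => ?_, ?_⟩
    · have := hT.2 x
      simp only [mem_sdiff, mem_compl, mem_union] at hx ⊢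
      tauto
    · rw [card_sdiff_of_subset hsub]
      omega
  · intro U hU
    simp only [mem_coe, mem_powersetCard] at hU
    have hU' : ∀ x, x ∈ U → (x ∈ R ∧ x ∉ S) ∨ (x ∈ S ∧ x ∉ R) := fun x hx => by
      simpa using hU.1 hx
    have hdisj : Disjoint U (R ∪ S)ᶜ := by
      rw [disjoint_left]
      intro x hx
      have := hU' x hx
      simp only [mem_compl, mem_union]
      tauto
    simp only [coe_filter, mem_univ, true_and, Set.mem_ofPred_eq]
    refine ⟨?_, fun x => ?_⟩
    · rw [card_union_of_disjoint hdisj]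
      omega
    · have := hU' x
      simp only [mem_compl, mem_union]
      tauto
  · intro T hT
    simp only [coe_filter, mem_univ, true_and, Set.mem_ofPred_eq] at hT
    ext x
    have := hT.2 x
    simp only [mem_sdiff, mem_compl, mem_union]
    tauto
  · intro U hU
    simp only [mem_coe, mem_powersetCard] at hU
    ext x
    have : x ∈ U → (x ∈ R ∧ x ∉ S) ∨ (x ∈ S ∧ x ∉ R) := fun hx => by
      simpa using hU.1 hx
    simp only [mem_sdiff, mem_compl, mem_union]
    tauto

theorem card_filter_card_sdiff_eq {k i : ℕ} (hι : Fintype.card ι = 2 * k) {R : Finset ι}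
    (hR : #R = k) (hi : i ≤ k) :
    #{S ∈ powersetCard k (univ : Finset ι) | #(R \ S) = i} = k.choose i ^ 2 := by
  have hRc : #Rᶜ = k := by rw [card_compl, hι, hR]; omega
  have : k.choose i ^ 2 = #(powersetCard i R ×ˢ powersetCard i Rᶜ) := by
    rw [card_product, card_powersetCard, card_powersetCard, hR, hRc, sq]
  rw [this]
  refine Finset.card_nbij' (fun S => (R \ S, S \ R)) (fun p => (R \ p.1) ∪ p.2) ?_ ?_ ?_ ?_
  · intro S hS
    simp only [coe_filter, mem_powersetCard_univ, Set.mem_ofPred_eq] at hS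
    have h1 := card_sdiff_add_card_inter R S
    have h2 := card_sdiff_add_card_inter S R
    rw [inter_comm] at h2
    simp only [mem_coe, mem_product, mem_powersetCard]
    refine ⟨⟨sdiff_subset, hS.2⟩, fun x hx => ?_, by omega⟩
    simp only [mem_sdiff, mem_compl] at hx ⊢
    exact hx.2
  · rintro ⟨A, B⟩ h
    simp only [mem_coe, mem_product, mem_powersetCard] at h
    obtain ⟨⟨hA, hAi⟩, hB, hBi⟩ := h
    have hB' : ∀ x, x ∈ B → x ∉ R := fun x hx => by simpa using hB hx
    have hd : Disjoint (R \ A) B := by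
      rw [disjoint_left]
      intro x hx hxB
      exact hB' x hxB (mem_sdiff.1 hx).1
    have hRA : R \ (R \ A ∪ B) = A := by
      ext x
      have := hB' x
      have := @hA x
      simp only [mem_sdiff, mem_union]
      tauto
    simp only [coe_filter, mem_powersetCard_univ, Set.mem_ofPred_eq]
    refine ⟨?_, by rw [hRA, hAi]⟩
    rw [card_union_of_disjoint hd, card_sdiff_of_subset hA]
    omega
  · intro S _
    ext x
    simp only [mem_sdiff, mem_union]
    tauto
  · rintro ⟨A, B⟩ h
    simp only [mem_coe, mem_product, mem_powersetCard] at h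
    obtain ⟨⟨hA, -⟩, hB, -⟩ := h
    have hB' : ∀ x, x ∈ B → x ∉ R := fun x hx => by simpa using hB hx
    refine Prod.ext ?_ ?_ <;>
    · ext x
      have := hB' x
      have := @hA x
      simp only [mem_sdiff, mem_union]
      tauto

theorem sum_choose_card_sdiff {k : ℕ} (hι : Fintype.card ι = 2 * k) {R : Finset ι}
    (hR : #R = k) :
    ∑ S ∈ powersetCard k (univ : Finset ι), (2 * #(R \ S)).choose #(R \ S) =
      ∑ i ∈ range (k + 1), k.choose i ^ 2 * (2 * i).choose i := by
  rw [← sum_fiberwise_of_maps_to (t := range (k + 1)) (g := fun S => #(R \ S))]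
  · refine sum_congr rfl fun i hi => ?_
    rw [← card_filter_card_sdiff_eq hι hR (Nat.lt_succ_iff.1 (mem_range.1 hi)), ← smul_eq_mul,
      ← sum_const]
    refine sum_congr rfl fun S hS => ?_
    rw [(mem_filter.1 hS).2]
  · intro S _
    have := card_le_card (sdiff_subset : R \ S ⊆ R)
    rw [mem_range]
    omega

end Counting

/-- A matrix in `goodA 3 (2 * k)` is determined by the sets of positions of the entries `1` in its
three rows. -/
theorem alpha_three_eq_card (k : ℕ) :
    alpha 3 (2 * k) = #((powersetCard k (univ : Finset (Fin (2 * k)))).sigma fun R =>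
      (powersetCard k (univ : Finset (Fin (2 * k)))).sigma fun S =>
        {T : Finset (Fin (2 * k)) |
          #T = k ∧ ∀ x, ¬(x ∈ R ∧ x ∈ S ∧ x ∈ T) ∧ (x ∈ R ∨ x ∈ S ∨ x ∈ T)}) := by
  rw [← Set.ncard_coe_finset]
  have mem_iff : ∀ M : Matrix (Fin 3) (Fin (2 * k)) ℤ, IsPM M → (M ∈ goodA 3 (2 * k) ↔
      (∀ i, #{j | M i j = 1} = k) ∧
        ∀ j, ¬(M 0 j = 1 ∧ M 1 j = 1 ∧ M 2 j = 1) ∧ (M 0 j = 1 ∨ M 1 j = 1 ∨ M 2 j = 1)) := by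
    intro M hM
    have hr : ∀ i, |∑ j, M i j| ≤ 1 ↔ #{j | M i j = 1} = k := fun i => by
      rw [sum_eq_of_pm _ (hM i), Fintype.card_fin, abs_le]
      push_cast
      omega
    have hc : ∀ j, |∑ i, M i j| ≤ 1 ↔
        ¬(M 0 j = 1 ∧ M 1 j = 1 ∧ M 2 j = 1) ∧ (M 0 j = 1 ∨ M 1 j = 1 ∨ M 2 j = 1) := fun j => by
      rw [Fin.sum_univ_three, abs_le]
      have h0 := hM 0 j
      have h1 := hM 1 j
      have h2 := hM 2 j
      omega
    simp only [goodA, Set.mem_ofPred_eq, hM, true_and, hr, hc]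
  refine Set.ncard_congr (fun M _ => ⟨({j | M 0 j = 1} : Finset (Fin (2 * k))),
    ({j | M 1 j = 1} : Finset (Fin (2 * k))), ({j | M 2 j = 1} : Finset (Fin (2 * k)))⟩) ?_ ?_ ?_
  · intro M hM
    obtain ⟨hr, hc⟩ := (mem_iff M hM.1).1 hM
    simpa [hr] using hc
  · intro M N hM hN h
    have key : ∀ i j, M i j = 1 ↔ N i j = 1 := by
      simp only [Sigma.mk.injEq, heq_eq_eq, Finset.ext_iff, mem_filter_univ] at h
      intro i
      fin_cases i
      exacts [h.1, h.2.1, h.2.2]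
    ext i j
    have := key i j
    have := hM.1 i j
    have := hN.1 i j
    omega
  · rintro ⟨R, S, T⟩ h
    simp only [mem_coe, mem_sigma, mem_powersetCard_univ, mem_filter_univ] at h
    obtain ⟨hR, hS, hT, hc⟩ := h
    have hpm : IsPM (Matrix.of fun i j => if j ∈ ![R, S, T] i then (1 : ℤ) else -1) := by
      intro i j
      simp only [Matrix.of_apply]
      split_ifs <;> simp
    have hone : ∀ i j, (Matrix.of fun i j => if j ∈ ![R, S, T] i then (1 : ℤ) else -1) i j = 1 ↔
        j ∈ ![R, S, T] i := by
      intro i j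
      simp only [Matrix.of_apply]
      split_ifs <;> simp [*]
    have hfilter : ∀ i, ({j | (Matrix.of fun i j => if j ∈ ![R, S, T] i then (1 : ℤ) else -1) i j
        = 1} : Finset (Fin (2 * k))) = ![R, S, T] i := by
      intro i
      ext j
      rw [mem_filter_univ, hone]
    refine ⟨_, (mem_iff _ hpm).2 ⟨fun i => ?_, fun j => ?_⟩, ?_⟩
    · rw [hfilter]
      fin_cases i <;> assumption
    · simp only [hone]
      exact hc j
    · simp only [hfilter]
      rfl

theorem alpha_three (k : ℕ) :
    alpha 3 (2 * k) = Nat.choose (2 * k) k *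
      ∑ i ∈ range (k + 1), (Nat.choose k i) ^ 2 * Nat.choose (2 * i) i := by
  have hι : Fintype.card (Fin (2 * k)) = 2 * k := Fintype.card_fin _
  rw [alpha_three_eq_card, card_sigma]
  have : ∀ R ∈ powersetCard k (univ : Finset (Fin (2 * k))),
      #((powersetCard k (univ : Finset (Fin (2 * k)))).sigma fun S =>
        {T : Finset (Fin (2 * k)) |
          #T = k ∧ ∀ x, ¬(x ∈ R ∧ x ∈ S ∧ x ∈ T) ∧ (x ∈ R ∨ x ∈ S ∨ x ∈ T)}) =
      ∑ i ∈ range (k + 1), (Nat.choose k i) ^ 2 * Nat.choose (2 * i) i := by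
    intro R hR
    rw [mem_powersetCard_univ] at hR
    rw [card_sigma, ← sum_choose_card_sdiff hι hR]
    refine sum_congr rfl fun S hS => ?_
    convert card_filter_third hι hR (mem_powersetCard_univ.1 hS)
  rw [sum_congr rfl this, sum_const, card_powersetCard, card_univ, hι, smul_eq_mul]

theorem stmt9 (k : ℕ) (hk : 0 < k) :
    alpha 4 (2 * k) = alpha 4 (2 * k - 1) ∧
    alpha 4 (2 * k - 1) = alpha 3 (2 * k) ∧
    alpha 3 (2 * k) =
      Nat.choose (2 * k) k *
        ∑ i ∈ Finset.range (k + 1), (Nat.choose k i) ^ 2 * Nat.choose (2 * i) i := by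
  have delete_col : alpha 4 (2 * k) = alpha 4 (2 * k - 1) := by
    have := alpha_succ_of_even_of_odd (m := 4) (n := 2 * k - 1) (by decide) ⟨k - 1, by omega⟩
    rwa [Nat.sub_add_cancel (by omega)] at this
  have delete_row : alpha 4 (2 * k) = alpha 3 (2 * k) := by
    rw [alpha_comm 4, alpha_comm 3]
    exact alpha_succ_of_even_of_odd (even_two_mul k) (by decide)
  exact ⟨delete_col, delete_col.symm.trans delete_row, alpha_three k⟩
end

section
/- Let m, n be positive integers, let r = (r₁,r₂,r₃,…,r_m) ∈ ℤ^m with r₁ ≥ r₂, let r' = (r₁+2, r₂-2, r₃,…,r_m), and let c ∈ ℤⁿ be any fixed column-sum vector. Then |A_{r,c}(m,n)| ≥ |A_{r',c}(m,n)|. -/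
open Finset

/-- `Arc m n r c` is the set A_{r,c}(m,n) of m×n ±1 matrices with row-sum vector
`r` and column-sum vector `c`. -/
def Arc (m n : ℕ) (r : Fin m → ℤ) (c : Fin n → ℤ) : Set (Matrix (Fin m) (Fin n) ℤ) :=
  {M | IsPM M ∧ (∀ i, ∑ j, M i j = r i) ∧ (∀ j, ∑ i, M i j = c j)}

/-- The difference of the sums of rows `a` and `b` of `M` over the first `k` columns. -/
def prefixDiff {m n : ℕ} (a b : Fin m) (M : Matrix (Fin m) (Fin n) ℤ) (k : ℕ) : ℤ :=
  ∑ j : Fin n, if (j : ℕ) < k then M a j - M b j else 0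

/-- Exchange rows `a` and `b` of `M` in the first `k` columns. -/
def swapPrefix {m n : ℕ} (a b : Fin m) (k : ℕ) (M : Matrix (Fin m) (Fin n) ℤ) :
    Matrix (Fin m) (Fin n) ℤ :=
  fun i j => if (j : ℕ) < k then M (Equiv.swap a b i) j else M i j

section SwapPrefix

variable {m n : ℕ} (a b : Fin m) (M : Matrix (Fin m) (Fin n) ℤ)

lemma swapPrefix_swapPrefix (k : ℕ) : swapPrefix a b k (swapPrefix a b k M) = M := by
  ext i j
  by_cases h : (j : ℕ) < k <;> simp [swapPrefix, h]

lemma prefixDiff_swapPrefix {k l : ℕ} (hl : l ≤ k) :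
    prefixDiff a b (swapPrefix a b k M) l = -prefixDiff a b M l := by
  rw [prefixDiff, prefixDiff, ← Finset.sum_neg_distrib]
  refine Finset.sum_congr rfl fun j _ => ?_
  by_cases h : (j : ℕ) < l
  · simp [swapPrefix, h, h.trans_le hl]
  · simp [h]

lemma sum_col_swapPrefix (k : ℕ) (j : Fin n) :
    ∑ i, swapPrefix a b k M i j = ∑ i, M i j := by
  by_cases h : (j : ℕ) < k
  · simpa [swapPrefix, h] using Equiv.sum_comp (Equiv.swap a b) fun i => M i j
  · simp [swapPrefix, h]

lemma sum_row_swapPrefix_left (k : ℕ) :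
    ∑ j, swapPrefix a b k M a j = ∑ j, M a j - prefixDiff a b M k := by
  rw [prefixDiff, ← Finset.sum_sub_distrib]
  refine Finset.sum_congr rfl fun j _ => ?_
  by_cases h : (j : ℕ) < k <;> simp [swapPrefix, h]

lemma sum_row_swapPrefix_right (k : ℕ) :
    ∑ j, swapPrefix a b k M b j = ∑ j, M b j + prefixDiff a b M k := by
  rw [prefixDiff, ← Finset.sum_add_distrib]
  refine Finset.sum_congr rfl fun j _ => ?_
  by_cases h : (j : ℕ) < k <;> simp [swapPrefix, h]

lemma sum_row_swapPrefix_of_ne (k : ℕ) {i : Fin m} (ha : i ≠ a) (hb : i ≠ b) :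
    ∑ j, swapPrefix a b k M i j = ∑ j, M i j := by
  simp [swapPrefix, Equiv.swap_apply_of_ne_of_ne ha hb]

variable {M}

lemma IsPM.swapPrefix (hM : IsPM M) (k : ℕ) : IsPM (swapPrefix a b k M) := by
  intro i j
  unfold _root_.swapPrefix
  split_ifs <;> exact hM _ _

lemma IsPM.prefixDiff_succ (hM : IsPM M) (k : ℕ) :
    prefixDiff a b M (k + 1) = prefixDiff a b M k - 2 ∨
      prefixDiff a b M (k + 1) = prefixDiff a b M k ∨
      prefixDiff a b M (k + 1) = prefixDiff a b M k + 2 := by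
  have key : prefixDiff a b M (k + 1) - prefixDiff a b M k =
      ∑ j : Fin n, if (j : ℕ) = k then M a j - M b j else 0 := by
    rw [prefixDiff, prefixDiff, ← Finset.sum_sub_distrib]
    refine Finset.sum_congr rfl fun j _ => ?_
    split_ifs <;> omega
  by_cases hk : k < n
  · have hsum : (∑ j : Fin n, if (j : ℕ) = k then M a j - M b j else 0) =
        M a ⟨k, hk⟩ - M b ⟨k, hk⟩ := by
      rw [Finset.sum_eq_single ⟨k, hk⟩]
      · simp
      · intro j _ hj
        exact if_neg fun h => hj (Fin.ext h)
      · simp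
    rw [hsum] at key
    rcases hM a ⟨k, hk⟩ with h | h <;> rcases hM b ⟨k, hk⟩ with h' | h' <;>
      rw [h, h'] at key <;> omega
  · have hsum : (∑ j : Fin n, if (j : ℕ) = k then M a j - M b j else 0) = 0 :=
      Finset.sum_eq_zero fun j _ => if_neg (by omega)
    omega

lemma IsPM.exists_prefixDiff_eq_two (hM : IsPM M) :
    ∀ k, 2 ≤ prefixDiff a b M k → ∃ l, prefixDiff a b M l = 2 := by
  have heven : ∀ k, Even (prefixDiff a b M k) := by
    intro k
    induction k with
    | zero => simp [prefixDiff]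
    | succ k ih =>
      rw [Int.even_iff] at ih ⊢
      have := hM.prefixDiff_succ a b k
      omega
  intro k
  induction k with
  | zero => simp [prefixDiff]
  | succ k ih =>
    intro hk
    by_cases h : 2 ≤ prefixDiff a b M k
    · exact ih h
    · have hk_even := Int.even_iff.mp (heven k)
      have := hM.prefixDiff_succ a b k
      exact ⟨k + 1, by omega⟩

lemma prefixDiff_eq_sum_sub_sum :
    prefixDiff a b M n = ∑ j, M a j - ∑ j, M b j := by
  simp [prefixDiff]

end SwapPrefix

/-- The first position at which the prefix difference equals `2`. -/
noncomputable def firstTwo {m n : ℕ} (a b : Fin m) (M : Matrix (Fin m) (Fin n) ℤ) : ℕ :=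
  sInf {k | prefixDiff a b M k = 2}

lemma firstTwo_le_of_swapPrefix_eq {m n : ℕ} {a b : Fin m} {M N : Matrix (Fin m) (Fin n) ℤ}
    (hM : prefixDiff a b M (firstTwo a b M) = 2)
    (h : swapPrefix a b (firstTwo a b M) M = swapPrefix a b (firstTwo a b N) N) :
    firstTwo a b N ≤ firstTwo a b M := by
  by_contra! hlt
  refine hlt.not_ge (Nat.sInf_le ?_)
  have h₁ := prefixDiff_swapPrefix a b M le_rfl (k := firstTwo a b M)
  rw [h, prefixDiff_swapPrefix a b N hlt.le] at h₁
  rw [Set.mem_ofPred_eq]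
  omega

lemma Arc_finite (m n : ℕ) (r : Fin m → ℤ) (c : Fin n → ℤ) : (Arc m n r c).Finite := by
  refine (Set.Finite.pi' fun _ : Fin m => Set.Finite.pi' fun _ : Fin n =>
    Set.toFinite ({1, -1} : Set ℤ)).subset ?_
  intro M hM i j
  simpa using hM.1 i j

theorem stmt13 (m n : ℕ) (hm : 2 ≤ m) (hn : 0 < n)
    (r : Fin m → ℤ) (c : Fin n → ℤ)
    (hr : r ⟨1, by omega⟩ ≤ r ⟨0, by omega⟩) :
    Set.ncard (Arc m n
      (fun i : Fin m =>
        if i = ⟨0, by omega⟩ then r i + 2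
        else if i = ⟨1, by omega⟩ then r i - 2
        else r i) c) ≤
    Set.ncard (Arc m n r c) := by
  set a : Fin m := ⟨0, by omega⟩ with ha
  set b : Fin m := ⟨1, by omega⟩ with hb
  have hba : b ≠ a := by simp [ha, hb]
  set r' : Fin m → ℤ := fun i => if i = a then r i + 2 else if i = b then r i - 2 else r i
  have hra : r' a = r a + 2 := by simp [r']
  have hrb : r' b = r b - 2 := by simp [r', hba]
  have hfirst : ∀ M ∈ Arc m n r' c, prefixDiff a b M (firstTwo a b M) = 2 := by
    rintro M ⟨hM, hrow, -⟩
    refine Nat.sInf_mem (s := {k | prefixDiff a b M k = 2})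
      (hM.exists_prefixDiff_eq_two a b n ?_)
    rw [prefixDiff_eq_sum_sub_sum, hrow, hrow]
    omega
  refine Set.ncard_le_ncard_of_injOn (fun M => swapPrefix a b (firstTwo a b M) M) ?_ ?_
    (Arc_finite m n r c)
  · intro M hM
    have htwo := hfirst M hM
    obtain ⟨hpm, hrow, hcol⟩ := hM
    refine ⟨hpm.swapPrefix a b _, fun i => ?_, fun j => ?_⟩
    · by_cases hia : i = a
      · rw [hia, sum_row_swapPrefix_left, hrow, htwo]
        omega
      by_cases hib : i = b
      · rw [hib, sum_row_swapPrefix_right, hrow, htwo]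
        omega
      rw [sum_row_swapPrefix_of_ne a b M _ hia hib, hrow]
      simp [r', hia, hib]
    · rw [sum_col_swapPrefix, hcol]
  · intro M hM N hN h
    have hk : firstTwo a b M = firstTwo a b N :=
      (firstTwo_le_of_swapPrefix_eq (hfirst N hN) h.symm).antisymm
        (firstTwo_le_of_swapPrefix_eq (hfirst M hM) h)
    dsimp only at h
    rw [hk] at h
    rw [← swapPrefix_swapPrefix a b M (firstTwo a b N), h, swapPrefix_swapPrefix]
end

section
/- For every fixed positive integer m, lim_{n→∞} α(m,n+2)/α(m,n) = α(m,1)² = C(2⌊(m+1)/2⌋, ⌊(m+1)/2⌋)², where C(a,b) denotes the binomial coefficient. -/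
open Finset

section
open Filter Topology

theorem tendsto_ratio_of_logConvex {a : ℕ → ℝ} {M : ℝ} {m : ℕ} (hM : 0 < M) (ha0 : a 0 = 1)
    (ha : ∀ k, 0 < a k) (hlc : ∀ k, a (k + 1) ^ 2 ≤ a k * a (k + 2))
    (hle : ∀ k, a (k + 1) ≤ M * a k) (hgr : ∀ k : ℕ, M ^ k ≤ (2 * (k : ℝ) + 1) ^ m * a k) :
    Tendsto (fun k => a (k + 1) / a k) atTop (𝓝 M) := by
  have hmono : Monotone fun k => a (k + 1) / a k := by
    refine monotone_nat_of_le_succ fun k => ?_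
    rw [div_le_div_iff₀ (ha _) (ha _)]
    nlinarith [hlc k]
  have hbd : ∀ k, a (k + 1) / a k ≤ M := fun k => (div_le_iff₀ (ha k)).2 (hle k)
  have hb : BddAbove (Set.range fun k => a (k + 1) / a k) := ⟨M, by rintro _ ⟨k, rfl⟩; exact hbd k⟩
  have hlim := tendsto_atTop_ciSup hmono hb
  set L := ⨆ k, a (k + 1) / a k with hL
  have hrL : ∀ k, a (k + 1) / a k ≤ L := fun k => le_ciSup hb k
  have hLM : L ≤ M := ciSup_le hbd
  have hLpos : 0 < L := (div_pos (ha 1) (ha 0)).trans_le (hrL 0)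
  have haL : ∀ k, a k ≤ L ^ k := by
    intro k
    induction k with
    | zero => simp [ha0]
    | succ k ih =>
      have := (div_le_iff₀ (ha k)).1 (hrL k)
      calc a (k + 1) ≤ L * a k := this
        _ ≤ L * L ^ k := by gcongr
        _ = L ^ (k + 1) := by ring
  rcases hLM.eq_or_lt with h | h
  · rwa [h] at hlim
  exfalso
  have h1 : |L / M| < 1 := by
    rw [abs_of_pos (div_pos hLpos hM)]; exact (div_lt_one hM).2 h
  have h2 := (tendsto_pow_const_mul_const_pow_of_abs_lt_one m h1).const_mul ((3 : ℝ) ^ m)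
  rw [mul_zero] at h2
  obtain ⟨k, hk, hk1⟩ := ((h2.eventually (gt_mem_nhds one_pos)).and (eventually_ge_atTop 1)).exists
  have hk1' : (1 : ℝ) ≤ k := by exact_mod_cast hk1
  have : M ^ k ≤ (3 * k : ℝ) ^ m * L ^ k := (hgr k).trans <| by
    have := (ha k).le
    refine mul_le_mul (pow_le_pow_left₀ (by positivity) (by linarith) m) (haL k) this (by positivity)
  rw [mul_pow] at this
  rw [div_pow] at hk
  have hMk : 0 < M ^ k := pow_pos hM k
  have e : (3 : ℝ) ^ m * (k ^ m * (L ^ k / M ^ k)) = 3 ^ m * k ^ m * L ^ k / M ^ k := by ring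
  rw [e, div_lt_one hMk] at hk
  linarith

theorem tendsto_shift_ratio {a : ℕ → ℝ} {M : ℝ} (ha : ∀ k, 0 < a k)
    (h : Tendsto (fun k => a (k + 1) / a k) atTop (𝓝 M)) (j : ℕ) :
    Tendsto (fun k => a (k + j) / a k) atTop (𝓝 (M ^ j)) := by
  induction j with
  | zero => simpa using tendsto_const_nhds.congr fun k => (div_self (ha k).ne').symm
  | succ j ih =>
    have h1 := (h.comp (tendsto_add_atTop_nat j)).mul ih
    rw [pow_succ']
    refine h1.congr fun k => ?_
    have := (ha k).ne'
    have := (ha (k + j)).ne'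
    simp only [Function.comp]
    rw [← add_assoc]
    field_simp

theorem tendsto_of_even_of_odd {f : ℕ → ℝ} {l : Filter ℝ}
    (h0 : Tendsto (fun k => f (2 * k)) atTop l) (h1 : Tendsto (fun k => f (2 * k + 1)) atTop l) :
    Tendsto f atTop l := by
  intro s hs
  obtain ⟨p, hp⟩ := mem_atTop_sets.1 (h0 hs)
  obtain ⟨q, hq⟩ := mem_atTop_sets.1 (h1 hs)
  refine mem_atTop_sets.2 ⟨2 * (p + q), fun n hn => ?_⟩
  obtain ⟨k, rfl | rfl⟩ := Nat.even_or_odd' n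
  · exact hp k (by lia)
  · exact hq k (by lia)

theorem tendsto_step_two_ratio {a A : ℕ → ℝ} {M C D : ℝ} (ha : ∀ k, 0 < a k)
    (h : Tendsto (fun k => a (k + 1) / a k) atTop (𝓝 M)) (hC : C ≠ 0) (hD : D ≠ 0)
    (h0 : Tendsto (fun k => A (2 * k) / a k) atTop (𝓝 C))
    (h1 : Tendsto (fun k => A (2 * k + 1) / a k) atTop (𝓝 D)) :
    Tendsto (fun n => A (n + 2) / A n) atTop (𝓝 M) := by
  have key : ∀ (b : ℕ → ℝ) (c : ℝ), c ≠ 0 → Tendsto (fun k => b k / a k) atTop (𝓝 c) →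
      Tendsto (fun k => b (k + 1) / b k) atTop (𝓝 M) := by
    intro b c hc hb
    have h2 := (((hb.comp (tendsto_add_atTop_nat 1)).mul h).div hb hc)
    rw [mul_div_cancel_left₀ _ hc] at h2
    refine h2.congr fun k => ?_
    have := (ha k).ne'
    have := (ha (k + 1)).ne'
    simp only [Function.comp, Pi.div_apply]
    rcases eq_or_ne (b k) 0 with hz | hz
    · simp [hz]
    field_simp
  exact tendsto_of_even_of_odd (key _ _ hC h0) (key _ _ hD h1)

/-- The number of `n`-step walks from `0` to `x` with steps in `V`. -/
noncomputable def walkCount {m : ℕ} (V : Finset (Fin m → ℤ)) (n : ℕ) (x : Fin m → ℤ) : ℕ :=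
  #{f ∈ Fintype.piFinset fun _ : Fin n => V | ∑ i, f i = x}

section Walk
variable {m : ℕ} {V : Finset (Fin m → ℤ)}

theorem sum_walkCount (n : ℕ) (B : Finset (Fin m → ℤ)) :
    ∑ b ∈ B, walkCount V n b = #{f ∈ Fintype.piFinset fun _ : Fin n => V | ∑ i, f i ∈ B} := by
  rw [card_eq_sum_card_fiberwise (s := {f ∈ Fintype.piFinset fun _ : Fin n => V | ∑ i, f i ∈ B})
    (f := fun f : Fin n → Fin m → ℤ => ∑ i, f i) (t := B) (fun f hf => (mem_filter.1 hf).2)]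
  refine sum_congr rfl fun b hb => ?_
  rw [walkCount, filter_filter]
  congr 1
  refine filter_congr fun f _ => ?_
  constructor
  · rintro rfl; exact ⟨hb, rfl⟩
  · exact fun h => h.2

theorem walkCount_zero (x : Fin m → ℤ) : walkCount V 0 x = if x = 0 then 1 else 0 := by
  unfold walkCount
  split_ifs with h
  · subst h; simp
  · rw [card_eq_zero, filter_eq_empty_iff]
    intro f _; simpa using Ne.symm h

theorem walkCount_succ (n : ℕ) (x : Fin m → ℤ) :
    walkCount V (n + 1) x = ∑ v ∈ V, walkCount V n (x - v) := by
  unfold walkCount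
  rw [card_eq_sum_card_fiberwise (f := fun f : Fin (n + 1) → Fin m → ℤ => f 0) (t := V)
    (fun f hf => Fintype.mem_piFinset.1 (mem_filter.1 hf).1 0)]
  refine sum_congr rfl fun v hv => ?_
  refine card_nbij' (fun f => Fin.tail f) (fun f => Fin.cons v f) ?_ ?_ ?_ ?_
  · intro f hf
    simp only [coe_filter, mem_filter, Fintype.mem_piFinset, Set.mem_ofPred_eq, Fin.sum_univ_succ] at hf ⊢
    refine ⟨fun i => hf.1.1 _, ?_⟩
    rw [← hf.1.2, ← hf.2]
    simp [Fin.tail]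
  · intro f hf
    simp only [coe_filter, mem_filter, Fintype.mem_piFinset, Set.mem_ofPred_eq, Fin.sum_univ_succ] at hf ⊢
    refine ⟨⟨fun i => ?_, ?_⟩, by simp⟩
    · refine Fin.cases ?_ ?_ i
      · simpa using hv
      · simpa using hf.1
    · simp [hf.2]
  · intro f hf
    simp only [coe_filter, mem_filter, Set.mem_ofPred_eq] at hf
    rw [← hf.2]; exact Fin.cons_self_tail f
  · intro f _; simp

theorem walkCount_neg (hV : ∀ v ∈ V, -v ∈ V) (n : ℕ) (x : Fin m → ℤ) :
    walkCount V n (-x) = walkCount V n x := by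
  induction n generalizing x with
  | zero => simp [walkCount_zero]
  | succ n ih =>
    rw [walkCount_succ, walkCount_succ]
    refine sum_nbij' (fun v => -v) (fun v => -v) hV hV (by simp) (by simp) fun v _ => ?_
    rw [← ih]; congr 1; abel

/-- The cube `[-n, n]^m`. -/
noncomputable def cube (m n : ℕ) : Finset (Fin m → ℤ) := Fintype.piFinset fun _ => Icc (-n : ℤ) n

theorem mem_cube {n : ℕ} {x : Fin m → ℤ} : x ∈ cube m n ↔ ∀ i, |x i| ≤ n := by
  simp [cube, abs_le]

theorem card_cube (m n : ℕ) : #(cube m n) = (2 * n + 1) ^ m := by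
  simp only [cube, Fintype.card_piFinset, Int.card_Icc, prod_const, card_univ, Fintype.card_fin]
  congr 1; lia

theorem sum_mem_cube (hV1 : V ⊆ cube m 1) {n : ℕ} {f : Fin n → Fin m → ℤ} (hf : ∀ i, f i ∈ V) :
    ∑ i, f i ∈ cube m n := by
  rw [mem_cube]
  intro j
  rw [Finset.sum_apply]
  refine (abs_sum_le_sum_abs _ _).trans ?_
  refine (sum_le_card_nsmul _ _ 1 fun i _ => ?_).trans (by simp)
  simpa using mem_cube.1 (hV1 (hf i)) j

theorem walkCount_eq_zero (hV1 : V ⊆ cube m 1) {n : ℕ} {x : Fin m → ℤ} (hx : x ∉ cube m n) :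
    walkCount V n x = 0 := by
  rw [walkCount, card_eq_zero, filter_eq_empty_iff]
  rintro f hf rfl
  exact hx (sum_mem_cube hV1 (Fintype.mem_piFinset.1 hf))

theorem sum_cube_walkCount (hV1 : V ⊆ cube m 1) (n : ℕ) :
    ∑ x ∈ cube m n, walkCount V n x = #V ^ n := by
  rw [sum_walkCount, filter_true_of_mem]
  · simp
  · exact fun f hf => sum_mem_cube hV1 (Fintype.mem_piFinset.1 hf)

theorem walkCount_add {j : ℕ} (k : ℕ) {T : Finset (Fin m → ℤ)}
    (hT : ∀ x ∉ T, walkCount V j x = 0) (x : Fin m → ℤ) :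
    walkCount V (j + k) x = ∑ y ∈ T, walkCount V j y * walkCount V k (x - y) := by
  induction k generalizing x with
  | zero =>
    simp only [walkCount_zero, sub_eq_zero, mul_ite, mul_one, mul_zero, add_zero, sum_ite_eq]
    split_ifs with h
    · rfl
    · exact hT x h
  | succ k ih =>
    rw [← add_assoc, walkCount_succ]
    simp_rw [ih, walkCount_succ k, mul_sum]
    rw [sum_comm]
    simp_rw [sub_right_comm]

theorem sum_sq_walkCount_le (hV1 : V ⊆ cube m 1) (hV : ∀ v ∈ V, -v ∈ V) (k : ℕ)
    (T : Finset (Fin m → ℤ)) : ∑ y ∈ T, walkCount V k y ^ 2 ≤ walkCount V (2 * k) 0 := by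
  rw [two_mul, walkCount_add (T := T ∪ cube m k) k fun x hx =>
    walkCount_eq_zero hV1 fun h => hx (mem_union_right _ h)]
  simp_rw [zero_sub, walkCount_neg hV, ← sq]
  exact sum_le_sum_of_subset subset_union_left

theorem walkCount_sq_le (hV1 : V ⊆ cube m 1) (hV : ∀ v ∈ V, -v ∈ V) (j k : ℕ)
    (x : Fin m → ℤ) :
    walkCount V (j + k) x ^ 2 ≤ walkCount V (2 * j) 0 * walkCount V (2 * k) 0 := by
  rw [walkCount_add (T := cube m j) k fun x hx => walkCount_eq_zero hV1 hx]
  refine (sum_mul_sq_le_sq_mul_sq _ _ _).trans ?_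
  refine Nat.mul_le_mul (sum_sq_walkCount_le hV1 hV _ _) ?_
  have := sum_sq_walkCount_le hV1 hV k ((cube m j).image fun y => x - y)
  rwa [sum_image (fun a _ b _ h => by simpa using h)] at this

theorem walkCount_le (hV1 : V ⊆ cube m 1) (hV : ∀ v ∈ V, -v ∈ V) (k : ℕ) (x : Fin m → ℤ) :
    walkCount V (2 * k) x ≤ walkCount V (2 * k) 0 := by
  have := walkCount_sq_le hV1 hV k k x
  rw [← two_mul, ← sq] at this
  exact (Nat.pow_le_pow_iff_left two_ne_zero).1 this

theorem card_sq_pow_le (hV1 : V ⊆ cube m 1) (hV : ∀ v ∈ V, -v ∈ V) (k : ℕ) :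
    (#V ^ 2) ^ k ≤ (2 * k + 1) ^ m * walkCount V (2 * k) 0 := by
  rw [pow_right_comm, ← sum_cube_walkCount hV1, ← card_cube]
  exact sq_sum_le_card_mul_sum_sq.trans (Nat.mul_le_mul_left _ (sum_sq_walkCount_le hV1 hV _ _))

theorem walkCount_two_mul_pos (hV1 : V ⊆ cube m 1) (hV : ∀ v ∈ V, -v ∈ V) (hne : V.Nonempty)
    (k : ℕ) : 0 < walkCount V (2 * k) 0 :=
  pos_of_mul_pos_right ((pow_pos (pow_pos hne.card_pos 2) k).trans_le (card_sq_pow_le hV1 hV k))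
    (Nat.zero_le _)

theorem walkCount_two_mul_add (hV1 : V ⊆ cube m 1) (hV : ∀ v ∈ V, -v ∈ V) (j k : ℕ) :
    walkCount V (2 * (k + j)) 0 =
      ∑ y ∈ cube m (2 * j), walkCount V (2 * j) y * walkCount V (2 * k) y := by
  rw [mul_add, add_comm, walkCount_add (T := cube m (2 * j)) _ fun x hx => walkCount_eq_zero hV1 hx]
  simp_rw [zero_sub, walkCount_neg hV]

theorem walkCount_two_mul_succ_le (hV1 : V ⊆ cube m 1) (hV : ∀ v ∈ V, -v ∈ V) (k : ℕ) :
    walkCount V (2 * (k + 1)) 0 ≤ #V ^ 2 * walkCount V (2 * k) 0 := by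
  rw [walkCount_two_mul_add hV1 hV, ← mul_one 2, ← sum_cube_walkCount hV1, sum_mul]
  exact sum_le_sum fun y _ => Nat.mul_le_mul_left _ (walkCount_le hV1 hV _ _)

theorem tendsto_return_ratio (hV1 : V ⊆ cube m 1) (hV : ∀ v ∈ V, -v ∈ V) (hne : V.Nonempty) :
    Tendsto (fun k => (walkCount V (2 * (k + 1)) 0 : ℝ) / walkCount V (2 * k) 0) atTop
      (𝓝 ((#V : ℝ) ^ 2)) := by
  refine tendsto_ratio_of_logConvex (a := fun k => (walkCount V (2 * k) 0 : ℝ)) (m := m)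
    (pow_pos (by exact_mod_cast hne.card_pos) 2) (by simp [walkCount_zero])
    (fun k => by exact_mod_cast walkCount_two_mul_pos hV1 hV hne k) (fun k => ?_)
    (fun k => by exact_mod_cast walkCount_two_mul_succ_le hV1 hV k)
    (fun k => by exact_mod_cast card_sq_pow_le hV1 hV k)
  have := walkCount_sq_le hV1 hV k (k + 2) 0
  rw [show k + (k + 2) = 2 * (k + 1) by ring] at this
  exact_mod_cast this

theorem tendsto_walkCount_ratio_one (hV1 : V ⊆ cube m 1) (hV : ∀ v ∈ V, -v ∈ V)
    (hne : V.Nonempty) {j : ℕ} {x : Fin m → ℤ} (hx : walkCount V (2 * j) x ≠ 0) :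
    Tendsto (fun k => (walkCount V (2 * k) x : ℝ) / walkCount V (2 * k) 0) atTop (𝓝 1) := by
  have ha : ∀ k, (0 : ℝ) < walkCount V (2 * k) 0 := fun k => by
    exact_mod_cast walkCount_two_mul_pos hV1 hV hne k
  have hj := tendsto_shift_ratio ha (tendsto_return_ratio hV1 hV hne) j
  have hle : ∀ k y, (walkCount V (2 * k) y : ℝ) / walkCount V (2 * k) 0 ≤ 1 := fun k y =>
    (div_le_one (ha k)).2 (by exact_mod_cast walkCount_le hV1 hV k y)
  have hxc : x ∈ cube m (2 * j) := by
    by_contra h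
    exact hx (walkCount_eq_zero hV1 h)
  have hx1 : (1 : ℝ) ≤ walkCount V (2 * j) x := by exact_mod_cast Nat.one_le_iff_ne_zero.2 hx
  have hgap : ∀ k, 1 - (walkCount V (2 * k) x : ℝ) / walkCount V (2 * k) 0 ≤
      ((#V : ℝ) ^ 2) ^ j - (walkCount V (2 * (k + j)) 0 : ℝ) / walkCount V (2 * k) 0 := by
    intro k
    have e : ((#V : ℝ) ^ 2) ^ j - (walkCount V (2 * (k + j)) 0 : ℝ) / walkCount V (2 * k) 0 =
        ∑ y ∈ cube m (2 * j), (walkCount V (2 * j) y : ℝ) *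
          (1 - (walkCount V (2 * k) y : ℝ) / walkCount V (2 * k) 0) := by
      rw [← pow_mul, walkCount_two_mul_add hV1 hV, ← Nat.cast_pow, ← sum_cube_walkCount hV1]
      push_cast
      rw [sum_div, ← sum_sub_distrib]
      exact sum_congr rfl fun y _ => by ring
    rw [e]
    refine le_trans ?_ (single_le_sum (fun y _ => mul_nonneg (Nat.cast_nonneg _)
      (sub_nonneg.2 (hle k y))) hxc)
    exact le_mul_of_one_le_left (sub_nonneg.2 (hle k x)) hx1
  have hgap0 := hj.const_sub (((#V : ℝ) ^ 2) ^ j)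
  rw [sub_self] at hgap0
  have h0 := squeeze_zero (fun k => sub_nonneg.2 (hle k x)) hgap hgap0
  simpa using h0.const_sub 1

theorem exists_tendsto_walkCount_ratio (hV1 : V ⊆ cube m 1) (hV : ∀ v ∈ V, -v ∈ V)
    (hne : V.Nonempty) : ∃ c : (Fin m → ℤ) → ℝ, c 0 = 1 ∧ (∀ x, 0 ≤ c x) ∧ ∀ x,
      Tendsto (fun k => (walkCount V (2 * k) x : ℝ) / walkCount V (2 * k) 0) atTop (𝓝 (c x)) := by
  classical
  refine ⟨fun x => if ∃ j, walkCount V (2 * j) x ≠ 0 then 1 else 0, ?_, fun x => ?_, fun x => ?_⟩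
  · exact if_pos ⟨0, by simp [walkCount_zero]⟩
  · positivity
  · dsimp only
    split_ifs with h
    · exact tendsto_walkCount_ratio_one hV1 hV hne h.choose_spec
    · push Not at h
      simp [h]

/-- The number of `n`-step walks ending in a finite set `B` which contains the origin and meets
the step set grows by asymptotically the same factor every two steps as the number of all walks. -/
theorem tendsto_walk_ratio (hV1 : V ⊆ cube m 1) (hV : ∀ v ∈ V, -v ∈ V) {B : Finset (Fin m → ℤ)}
    (h0 : 0 ∈ B) {w : Fin m → ℤ} (hw : w ∈ V) (hwB : w ∈ B) :
    Tendsto (fun n => ((∑ b ∈ B, walkCount V (n + 2) b : ℕ) : ℝ) /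
      (∑ b ∈ B, walkCount V n b : ℕ)) atTop (𝓝 ((#V : ℝ) ^ 2)) := by
  have hne : V.Nonempty := ⟨w, hw⟩
  obtain ⟨c, hc0, hc, hlim⟩ := exists_tendsto_walkCount_ratio hV1 hV hne
  refine tendsto_step_two_ratio (A := fun n => ((∑ b ∈ B, walkCount V n b : ℕ) : ℝ))
    (a := fun k => (walkCount V (2 * k) 0 : ℝ)) (C := ∑ b ∈ B, c b)
    (D := ∑ b ∈ B, ∑ v ∈ V, c (b - v))
    (fun k => by exact_mod_cast walkCount_two_mul_pos hV1 hV hne k)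
    (tendsto_return_ratio hV1 hV hne) ?_ ?_ ?_ ?_
  · exact (sum_pos' (fun b _ => hc b) ⟨0, h0, by simp [hc0]⟩).ne'
  · exact (sum_pos' (fun b _ => sum_nonneg fun v _ => hc _) ⟨w, hwB,
      sum_pos' (fun v _ => hc _) ⟨w, hw, by simp [hc0]⟩⟩).ne'
  · refine (tendsto_finsetSum B fun b _ => hlim b).congr fun k => ?_
    rw [Nat.cast_sum, sum_div]
  · refine (tendsto_finsetSum B fun b _ => tendsto_finsetSum V fun v _ => hlim (b - v)).congr
      fun k => ?_
    simp_rw [walkCount_succ, Nat.cast_sum, sum_div]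

end Walk

/-- The `±1` vectors of length `m` whose sum has absolute value at most `1`. -/
noncomputable def signVectors (m : ℕ) : Finset (Fin m → ℤ) :=
  {v ∈ Fintype.piFinset fun _ => {1, -1} | |∑ i, v i| ≤ 1}

theorem mem_signVectors {m : ℕ} {v : Fin m → ℤ} :
    v ∈ signVectors m ↔ (∀ i, v i = 1 ∨ v i = -1) ∧ |∑ i, v i| ≤ 1 := by
  simp [signVectors]

theorem neg_mem_signVectors {m : ℕ} : ∀ v ∈ signVectors m, -v ∈ signVectors m := by
  intro v hv
  rw [mem_signVectors] at hv ⊢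
  refine ⟨fun i => ?_, by simpa using hv.2⟩
  rcases hv.1 i with h | h <;> simp [h]

theorem signVectors_subset_cube (m : ℕ) : signVectors m ⊆ cube m 1 := by
  intro v hv
  rw [mem_cube]
  intro i
  rcases (mem_signVectors.1 hv).1 i with h | h <;> simp [h]

theorem alpha_eq_sum_walkCount (m n : ℕ) :
    alpha m n = ∑ b ∈ cube m 1, walkCount (signVectors m) n b := by
  rw [sum_walkCount, alpha, ← Set.ncard_coe_finset,
    ← Set.ncard_image_of_injective _
      (f := fun f : Fin n → Fin m → ℤ => (Matrix.of f).transpose)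
      (Matrix.transpose_injective.comp Matrix.of.injective)]
  congr 1
  ext M
  simp only [goodA, IsPM, Set.mem_ofPred_eq, Set.mem_image, coe_filter, Fintype.mem_piFinset,
    mem_signVectors, mem_cube, Finset.sum_apply, Nat.cast_one]
  constructor
  · rintro ⟨h1, h2, h3⟩
    exact ⟨M.transpose, ⟨fun j => ⟨fun i => h1 i j, h3 j⟩, h2⟩, M.transpose_transpose⟩
  · rintro ⟨f, ⟨h1, h2⟩, rfl⟩
    exact ⟨fun i j => (h1 j).1 i, h2, fun j => (h1 j).2⟩

theorem alpha_one (m : ℕ) : alpha m 1 = #(signVectors m) := by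
  rw [alpha_eq_sum_walkCount, sum_cube_walkCount (signVectors_subset_cube m), pow_one]

theorem sum_sign_eq {m : ℕ} {v : Fin m → ℤ} (hv : ∀ i, v i = 1 ∨ v i = -1) :
    ∑ i, v i = 2 * (#{i | v i = 1} : ℤ) - m := by
  have h : ∀ i, v i = 2 * (if v i = 1 then 1 else 0) - 1 := fun i => by
    rcases hv i with h | h <;> simp [h]
  rw [sum_congr rfl fun i _ => h i, sum_sub_distrib, ← mul_sum]
  simp

theorem card_signVectors_eq (m : ℕ) :
    #(signVectors m) = #{s : Finset (Fin m) | |2 * (#s : ℤ) - m| ≤ 1} := by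
  refine card_nbij' (fun v => ({i | v i = 1} : Finset (Fin m)))
    (fun s i => if i ∈ s then 1 else -1) ?_ ?_ ?_ ?_
  · intro v hv
    have hv := mem_signVectors.1 hv
    simpa [← sum_sign_eq hv.1] using hv.2
  · intro s hs
    have h : ∀ i, (if i ∈ s then (1 : ℤ) else -1) = 1 ∨ (if i ∈ s then (1 : ℤ) else -1) = -1 :=
      fun i => by split_ifs <;> simp
    refine mem_signVectors.2 ⟨h, ?_⟩
    rw [sum_sign_eq h]
    have e : ({i | (if i ∈ s then (1 : ℤ) else -1) = 1} : Finset (Fin m)) = s := by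
      ext i; by_cases hi : i ∈ s <;> simp [hi]
    rw [e]
    simpa using hs
  · intro v hv
    funext i
    rcases (mem_signVectors.1 hv).1 i with h | h <;> simp [h]
  · intro s _
    ext i; by_cases hi : i ∈ s <;> simp [hi]

theorem card_signVectors (m : ℕ) :
    #(signVectors m) = Nat.choose (2 * ((m + 1) / 2)) ((m + 1) / 2) := by
  rw [card_signVectors_eq]
  obtain ⟨p, rfl | rfl⟩ := Nat.even_or_odd' m
  · have e : ({s | |2 * (#s : ℤ) - (2 * p : ℕ)| ≤ 1} : Finset (Finset (Fin (2 * p)))) =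
        powersetCard p univ := by
      ext s
      simp only [mem_filter, mem_univ, true_and, mem_powersetCard, subset_univ, abs_le]
      lia
    rw [e, card_powersetCard, card_univ, Fintype.card_fin, show (2 * p + 1) / 2 = p by lia]
  · have e : ({s | |2 * (#s : ℤ) - (2 * p + 1 : ℕ)| ≤ 1} : Finset (Finset (Fin (2 * p + 1)))) =
        powersetCard p univ ∪ powersetCard (p + 1) univ := by
      ext s
      simp only [mem_filter, mem_univ, true_and, mem_union, mem_powersetCard, subset_univ, abs_le]
      lia
    have hd : Disjoint (powersetCard p (univ : Finset (Fin (2 * p + 1))))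
        (powersetCard (p + 1) univ) := pairwise_disjoint_powersetCard _ (by simp)
    rw [e, card_union_of_disjoint hd, card_powersetCard, card_powersetCard, card_univ,
      Fintype.card_fin, show (2 * p + 1 + 1) / 2 = p + 1 by lia,
      show 2 * (p + 1) = 2 * p + 1 + 1 by ring, Nat.choose_succ_succ' (2 * p + 1)]

end

open Filter in
theorem stmt16 (m : ℕ) (hm : 0 < m) :
    Tendsto (fun n : ℕ => (alpha m (n + 2) : ℝ) / (alpha m n : ℝ))
      atTop (nhds ((alpha m 1 : ℝ) ^ 2)) ∧
    alpha m 1 = Nat.choose (2 * ((m + 1) / 2)) ((m + 1) / 2) := by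
  refine ⟨?_, (alpha_one m).trans (card_signVectors m)⟩
  obtain ⟨w, hw⟩ : (signVectors m).Nonempty := by
    rw [← card_pos, card_signVectors]
    exact Nat.choose_pos (by lia)
  have hcube := signVectors_subset_cube m
  rw [alpha_one]
  simp_rw [alpha_eq_sum_walkCount]
  exact tendsto_walk_ratio hcube neg_mem_signVectors (by simp [mem_cube]) hw (hcube hw)
end
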